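/- arXiv:1910.13640 — 5 statements merged into one kernel-verified Lean document; each statement's English description precedes it below -/
import Mathlib

section
/- In the setting of the discrete heat kernel G, let m∈ℕ and η₁,…,η_m∈ℤ^d, and set L=δ_{η₁}⋯δ_{η_m}. There is a constant N, depending only on d, d₁, δ₁*, δ₂*, m, ρ, the vectors l₁,…,l_{d₁} and η₁,…,η_m, with the following property. Let r∈ℕ, let (n,x)∈Q_r(0,0) (i.e. |n|<r² and ‖x‖<r), let j∈ℤ with j≤n−r², and let g : ℤ×ℤ^d→ℝ be finitely supported. Then | Σ_{y∈ℤ^d} L G(j,n,y) g(j,x−y) | ≤ N (n−j)^{−m/2} ℳ_x g(j,0). -/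
open scoped ENNReal BigOperators

noncomputable section

/-- standard basis vector of `ℤ^d`. -/
def stdE (d : ℕ) (i : Fin d) : Fin d → ℤ := fun j => if j = i then 1 else 0

/-- forward difference quotient `δ_{ξ,h} f (x) = (f(x+hξ) - f(x))/h`, in lattice
representation (a function on `hℤ^d` is represented by its values on `ℤ^d`). -/
def fdiff {d : ℕ} (h : ℝ) (ξ : Fin d → ℤ) (f : (Fin d → ℤ) → ℝ) : (Fin d → ℤ) → ℝ :=
  fun x => (f (x + ξ) - f x) / h

/-- second difference quotient `Δ_{ξ,h} f (x) = (f(x+hξ) - 2f(x) + f(x-hξ))/h²`. -/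
def sdiff {d : ℕ} (h : ℝ) (ξ : Fin d → ℤ) (f : (Fin d → ℤ) → ℝ) : (Fin d → ℤ) → ℝ :=
  fun x => (f (x + ξ) - 2 * f x + f (x - ξ)) / h ^ 2

/-- mixed difference `δ^α_h = δ_{e_1,h}^{α_1} ⋯ δ_{e_d,h}^{α_d}`. -/
def mdiff {d : ℕ} (h : ℝ) (α : Fin d → ℕ) (f : (Fin d → ℤ) → ℝ) : (Fin d → ℤ) → ℝ :=
  (List.finRange d).foldr (fun i g => (fdiff h (stdE d i))^[α i] g) f

/-- discrete `l_p` norm `‖f‖_{p;h} = (h^d Σ_x |f(x)|^p)^{1/p}`. -/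
def lpN {d : ℕ} (p h : ℝ) (f : (Fin d → ℤ) → ℝ) : ℝ≥0∞ :=
  (ENNReal.ofReal h ^ d * ∑' x : Fin d → ℤ, ENNReal.ofReal (|f x| ^ p)) ^ (1 / p)

/-- discrete Sobolev seminorm `[f]_{s,p;h} = Σ_{|α|=s} ‖δ^α_h f‖_{p;h}`. -/
def semiN {d : ℕ} (p h : ℝ) (s : ℕ) (f : (Fin d → ℤ) → ℝ) : ℝ≥0∞ :=
  ∑ α ∈ Finset.univ.filter (fun α : Fin d → Fin (s + 1) => (∑ i, (α i : ℕ)) = s),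
    lpN p h (mdiff h (fun i => (α i : ℕ)) f)

/-- discrete Sobolev norm `‖f‖_{s,p;h} = Σ_{n=0}^s [f]_{n,p;h}`. -/
def sobN {d : ℕ} (p h : ℝ) (s : ℕ) (f : (Fin d → ℤ) → ℝ) : ℝ≥0∞ :=
  ∑ m ∈ Finset.range (s + 1), semiN p h m f

/-- `‖x‖ = max_i |x^i|` on `ℤ^d`, as a natural number. -/
def supNat {d : ℕ} (x : Fin d → ℤ) : ℕ := Finset.univ.sup fun i => (x i).natAbs

/-- the box `C_r(x) = Π_i ((x^i - r, x^i + r) ∩ ℤ)`. -/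
def Cbox {d : ℕ} (r : ℕ) (x : Fin d → ℤ) : Finset (Fin d → ℤ) :=
  Finset.Icc (fun i => x i - r + 1) (fun i => x i + r - 1)

/-- the spatial maximal function `ℳ_x g (t, x) = sup_{r ∈ ℕ} |C_r(x)|⁻¹ Σ_{y ∈ C_r(x)} |g(t,y)|`. -/
noncomputable def maxX {d : ℕ} (g : ℤ → (Fin d → ℤ) → ℝ) (t : ℤ) (x : Fin d → ℤ) : ℝ :=
  ⨆ r : ℕ+, (((2 * (r : ℕ) - 1 : ℕ) : ℝ) ^ d)⁻¹ * ∑ y ∈ Cbox (r : ℕ) x, |g t y|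

/-- the composite difference operator `L = δ_{η₁} ⋯ δ_{η_m}` (mesh size 1). -/
def Ldiff {d : ℕ} (ηs : List (Fin d → ℤ)) (f : (Fin d → ℤ) → ℝ) : (Fin d → ℤ) → ℝ :=
  ηs.foldr (fun η g => fun x => g (x + η) - g x) f

lemma termbd (D u v a b : ℝ) (hu : 0 ≤ u) (hv : 0 ≤ v) (hD : 0 < D) (h : u + 2 * v = D) :
    ‖((u : ℂ) + 2 * v * Complex.cosh (b + a * Complex.I))‖
      ≤ D - 2 * u * v / D * (1 - Real.cos a) + D * Real.sinh b ^ 2 := by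
  have e1 : ((u : ℂ) + 2 * v * Complex.cosh (b + a * Complex.I))
      = ((u + 2 * v * (Real.cosh b * Real.cos a) : ℝ) : ℂ)
        + ((2 * v * (Real.sinh b * Real.sin a) : ℝ) : ℂ) * Complex.I := by
    rw [Complex.cosh_add, Complex.cosh_mul_I, Complex.sinh_mul_I]
    push_cast
    ring
  have hc1 := Real.cos_le_one a
  have hc2 := Real.neg_one_le_cos a
  have hsc := Real.sin_sq_add_cos_sq a
  have hch := Real.cosh_sq b
  have hch1 := Real.one_le_cosh b
  have huv : 0 ≤ u * v := mul_nonneg hu hv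
  have hq : 2 * u * v / D * 2 ≤ D := by
    rw [div_mul_eq_mul_div, div_le_iff₀ hD]
    nlinarith [sq_nonneg (u - 2 * v)]
  have hq0 : 0 ≤ 2 * u * v / D := by positivity
  have hR : 0 ≤ D - 2 * u * v / D * (1 - Real.cos a) + D * Real.sinh b ^ 2 := by
    have : 0 ≤ D * Real.sinh b ^ 2 := by positivity
    nlinarith
  rw [e1, Complex.norm_add_mul_I]
  apply Real.sqrt_le_iff.2 ⟨hR, ?_⟩
  have hqD : 2 * u * v / D * D = 2 * u * v := by field_simp
  set q := 2 * u * v / D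
  set c := Real.cos a
  set s := Real.sinh b
  set C := Real.cosh b
  have hss : Real.sin a ^ 2 = 1 - c ^ 2 := by linarith
  have k1 : (u + 2 * v * (C * c)) ^ 2 + (2 * v * (s * Real.sin a)) ^ 2
      = u ^ 2 + 4 * (u * v) * (c * C) + 4 * v ^ 2 * (c ^ 2 + s ^ 2) := by
    have : (2 * v * (s * Real.sin a)) ^ 2 = 4 * v ^ 2 * s ^ 2 * Real.sin a ^ 2 := by ring
    rw [this, hss]
    have : (u + 2 * v * (C * c)) ^ 2 = u ^ 2 + 4 * (u * v) * (c * C) + 4 * v ^ 2 * c ^ 2 * C ^ 2 := by ring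
    rw [this, hch]; ring
  rw [k1]
  have k2 : C - 1 ≤ s ^ 2 := by nlinarith
  have k3 : c * C ≤ c + s ^ 2 := by nlinarith
  have k4 : c ^ 2 ≤ 1 := by nlinarith
  have k5 : 4 * (u * v) * (c * C) ≤ 4 * (u * v) * (c + s ^ 2) := by gcongr
  have k6 : 4 * v ^ 2 * (c ^ 2 + s ^ 2) ≤ 4 * v ^ 2 * (1 + s ^ 2) := by gcongr
  have k7 : (4 * (u * v) + 4 * v ^ 2) * s ^ 2 ≤ 2 * D ^ 2 * s ^ 2 := by
    gcongr; rw [← h]; nlinarith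
  have k8 : D ^ 2 + 2 * D * (-q * (1 - c) + D * s ^ 2) ≤ (D - q * (1 - c) + D * s ^ 2) ^ 2 := by
    nlinarith [sq_nonneg (-q * (1 - c) + D * s ^ 2)]
  have k9 : D ^ 2 = u ^ 2 + 4 * (u * v) + 4 * v ^ 2 := by rw [← h]; ring
  have k10 : 2 * D * (-q * (1 - c) + D * s ^ 2) = -(4 * (u * v)) * (1 - c) + 2 * D ^ 2 * s ^ 2 := by
    linear_combination (-2 * (1 - c)) * hqD
  nlinarith

/-- complex pairing -/
def dotc {d : ℕ} (w : Fin d → ℂ) (y : Fin d → ℤ) : ℂ := ∑ i, w i * (y i : ℂ)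

/-- complex frequency -/
def wv {d : ℕ} (θ ξ : Fin d → ℝ) : Fin d → ℂ := fun i => (θ i : ℂ) + (ξ i : ℂ) * Complex.I

/-- one-step multiplier -/
def phat {d d₁ : ℕ} (l : Fin d₁ → Fin d → ℤ) (ρ : ℝ) (lam : Fin d₁ → ℝ) (w : Fin d → ℂ) : ℂ :=
  1 + ρ * ∑ k, (lam k : ℂ) * (Complex.exp (-dotc w (l k)) - 2 + Complex.exp (dotc w (l k)))

lemma dotc_add {d : ℕ} (w : Fin d → ℂ) (y z : Fin d → ℤ) : dotc w (y + z) = dotc w y + dotc w z := by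
  simp [dotc, mul_add, Finset.sum_add_distrib]

lemma dotc_sub {d : ℕ} (w : Fin d → ℂ) (y z : Fin d → ℤ) : dotc w (y - z) = dotc w y - dotc w z := by
  simp [dotc, mul_sub, Finset.sum_sub_distrib]

lemma dotc_wv {d : ℕ} (θ ξ : Fin d → ℝ) (y : Fin d → ℤ) :
    dotc (wv θ ξ) y = ((∑ i, θ i * (y i : ℝ) : ℝ) : ℂ) + ((∑ i, ξ i * (y i : ℝ) : ℝ) : ℂ) * Complex.I := by
  simp only [dotc, wv]
  push_cast
  rw [Finset.sum_mul, ← Finset.sum_add_distrib]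
  exact Finset.sum_congr rfl fun i _ => by ring

lemma phat_bd {d d₁ : ℕ} (hd : 1 ≤ d) (hdd₁ : d ≤ d₁)
    (l : Fin d₁ → Fin d → ℤ) (hl : ∀ (k : Fin d₁) (hk : (k : ℕ) < d), l k = stdE d ⟨k, hk⟩)
    (δ₁ δ₂ : ℝ) (hδ₁ : 0 < δ₁) (hδ₁₂ : δ₁ ≤ δ₂)
    (ρ : ℝ) (hρ : 0 < ρ) (hρ' : ρ < (2 * d₁ * δ₂)⁻¹) :
    ∃ c : ℝ, 0 < c ∧ ∀ lam : Fin d₁ → ℝ, (∀ k, lam k ∈ Set.Icc δ₁ δ₂) →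
      ∀ θ ξ : Fin d → ℝ, (∀ i, |ξ i| ≤ Real.pi) → ∀ E : ℝ,
      (∀ k, Real.sinh (∑ i, θ i * (l k i : ℝ)) ^ 2 ≤ E) →
      ‖phat l ρ lam (wv θ ξ)‖ ≤ Real.exp (-c * ∑ i, ξ i ^ 2 + E) := by
  have hd1 : (0 : ℝ) < d₁ := by exact_mod_cast (by omega : 0 < d₁)
  have hδ₂ : 0 < δ₂ := lt_of_lt_of_le hδ₁ hδ₁₂
  set D : ℝ := 1 / d₁ with hDdef
  have hD : 0 < D := by positivity
  have hu0 : 0 < D - 2 * (ρ * δ₂) := by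
    have : ρ * (2 * d₁ * δ₂) < 1 := by
      rwa [lt_inv_comm₀ hρ (by positivity), lt_inv_comm₀ (by positivity) hρ, ← one_div, lt_div_iff₀ (by positivity)] at hρ'
    rw [hDdef, sub_pos, lt_div_iff₀ hd1]; linarith
  set u0 := D - 2 * (ρ * δ₂) with hu0def
  set c1 := 2 * u0 * (ρ * δ₁) / D with hc1
  have hc1p : 0 < c1 := by positivity
  refine ⟨c1 * (2 / Real.pi ^ 2), by positivity, ?_⟩
  intro lam hlam θ ξ hξ E hE
  have hsumD : ∑ _k : Fin d₁, D = 1 := by simp [hDdef]; field_simp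
  have e1 : phat l ρ lam (wv θ ξ) = ∑ k, (((D - 2 * (ρ * lam k) : ℝ) : ℂ) + 2 * ((ρ * lam k : ℝ) : ℂ) *
      Complex.cosh (((∑ i, θ i * (l k i : ℝ) : ℝ) : ℂ) + ((∑ i, ξ i * (l k i : ℝ) : ℝ) : ℂ) * Complex.I)) := by
    have : (1 : ℂ) = ∑ _k : Fin d₁, (D : ℂ) := by
      rw [← Complex.ofReal_sum, hsumD]; simp
    rw [phat, this, Finset.mul_sum, ← Finset.sum_add_distrib]
    refine Finset.sum_congr rfl fun k _ => ?_
    rw [← dotc_wv, Complex.cosh]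
    push_cast
    ring
  set f : Fin d₁ → ℝ := fun k => 1 - Real.cos (∑ i, ξ i * (l k i : ℝ)) with hf
  have hf0 : ∀ k, 0 ≤ f k := fun k => by simp only [hf]; linarith [Real.cos_le_one (∑ i, ξ i * (l k i : ℝ))]
  have e2 : ‖phat l ρ lam (wv θ ξ)‖ ≤ ∑ k, (D - c1 * f k + D * E) := by
    rw [e1]
    refine (norm_sum_le _ _).trans (Finset.sum_le_sum fun k _ => ?_)
    have h1 := (hlam k).1
    have h2 := (hlam k).2
    have hv1 : ρ * δ₁ ≤ ρ * lam k := by gcongr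
    have hv2 : ρ * lam k ≤ ρ * δ₂ := by gcongr
    have hv0 : 0 < ρ * δ₁ := by positivity
    refine (termbd D (D - 2 * (ρ * lam k)) (ρ * lam k) _ _ (by linarith) (by linarith) hD (by ring)).trans ?_
    have : c1 ≤ 2 * (D - 2 * (ρ * lam k)) * (ρ * lam k) / D := by
      rw [hc1]; gcongr <;> linarith
    have := mul_le_mul_of_nonneg_right this (hf0 k)
    have h3 := mul_le_mul_of_nonneg_left (hE k) hD.le
    simp only [hf] at this ⊢
    linarith
  have e3 : ∑ i, (2 / Real.pi ^ 2) * ξ i ^ 2 ≤ ∑ k, f k := by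
    have : ∑ i, (2 / Real.pi ^ 2) * ξ i ^ 2 ≤ ∑ i : Fin d, f (Fin.castLE hdd₁ i) := by
      refine Finset.sum_le_sum fun i _ => ?_
      have : ∑ i', ξ i' * (l (Fin.castLE hdd₁ i) i' : ℝ) = ξ i := by
        rw [hl _ (by simp)]
        simp [stdE]
      simp only [hf, this]
      have := Real.cos_le_one_sub_mul_cos_sq (hξ i)
      linarith
    refine this.trans ?_
    have h := Finset.sum_map Finset.univ (Fin.castLEEmb hdd₁) f
    simp only [Fin.castLEEmb_apply] at h
    rw [← h]
    exact Finset.sum_le_univ_sum_of_nonneg hf0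
  refine e2.trans ?_
  have e4 : ∑ k, (D - c1 * f k + D * E) = 1 - c1 * ∑ k, f k + E := by
    rw [Finset.sum_add_distrib, Finset.sum_sub_distrib, ← Finset.mul_sum, ← Finset.sum_mul, hsumD, one_mul]
  rw [e4]
  refine le_trans ?_ (Real.add_one_le_exp _)
  rw [← Finset.mul_sum] at e3
  have := mul_le_mul_of_nonneg_left e3 hc1p.le
  linarith
open MeasureTheory

/-- torus measure -/
def tor (d : ℕ) : Measure (Fin d → ℝ) :=
  Measure.pi (fun _ : Fin d => (volume : Measure ℝ).restrict (Set.Icc (-Real.pi) Real.pi))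

lemma tor_integrable {d : ℕ} {f : (Fin d → ℝ) → ℂ} (hf : Continuous f) : Integrable f (tor d) := by
  have : tor d = (volume : Measure (Fin d → ℝ)).restrict
      (Set.pi Set.univ fun _ => Set.Icc (-Real.pi) Real.pi) := by
    rw [tor, volume_pi, Measure.restrict_pi_pi]
  rw [this]
  exact hf.continuousOn.integrableOn_compact (isCompact_univ_pi fun _ => isCompact_Icc)

lemma tor_ae {d : ℕ} : ∀ᵐ ξ ∂(tor d), ∀ i, |ξ i| ≤ Real.pi := by
  rw [ae_all_iff]
  intro i
  have h : ∀ᵐ x ∂((volume : Measure ℝ).restrict (Set.Icc (-Real.pi) Real.pi)), |x| ≤ Real.pi := by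
    filter_upwards [ae_restrict_mem measurableSet_Icc] with x hx
    exact abs_le.2 hx
  exact (Measure.tendsto_eval_ae_ae
    (μ := fun _ : Fin d => (volume : Measure ℝ).restrict (Set.Icc (-Real.pi) Real.pi)) (i := i)).eventually h

lemma base1 (t : ℝ) (y : ℤ) :
    ∫ x in Set.Icc (-Real.pi) Real.pi, Complex.exp (-(((t : ℂ) + (x : ℂ) * Complex.I) * (y : ℂ)))
      = if y = 0 then 2 * (Real.pi : ℂ) else 0 := by
  split_ifs with hy
  · subst hy
    simp
    rw [max_eq_left (by positivity)]
    push_cast; ring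
  · have hy' : (y : ℂ) ≠ 0 := by exact_mod_cast hy
    have : ∀ x : ℝ, Complex.exp (-(((t : ℂ) + (x : ℂ) * Complex.I) * (y : ℂ)))
        = Complex.exp (-(t * y)) * Complex.exp ((-(y * Complex.I)) * x) := by
      intro x; rw [← Complex.exp_add]; congr 1; ring
    simp_rw [this]
    rw [integral_const_mul, integral_Icc_eq_integral_Ioc,
      ← intervalIntegral.integral_of_le (by linarith [Real.pi_pos]), integral_exp_mul_complex]
    · have : Complex.exp (-(y * Complex.I) * (Real.pi : ℝ)) = Complex.exp (-(y * Complex.I) * ((-Real.pi : ℝ) : ℂ)) := by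
        rw [Complex.exp_eq_exp_iff_exists_int]
        refine ⟨-y, ?_⟩
        push_cast; ring
      rw [this]; simp
    · simp [hy']

lemma base_int {d : ℕ} (θ : Fin d → ℝ) (y : Fin d → ℤ) :
    ∫ ξ, Complex.exp (-dotc (wv θ ξ) y) ∂(tor d) = (2 * (Real.pi : ℂ)) ^ d * (if y = 0 then 1 else 0) := by
  have : ∀ ξ : Fin d → ℝ, Complex.exp (-dotc (wv θ ξ) y)
      = ∏ i, (fun (i : Fin d) (x : ℝ) => Complex.exp (-(((θ i : ℂ) + (x : ℂ) * Complex.I) * (y i : ℂ)))) i (ξ i) := by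
    intro ξ
    rw [← Complex.exp_sum]
    simp [dotc, wv]
  simp_rw [this]
  rw [tor, integral_fintype_prod_eq_prod (𝕜 := ℂ) (fun (i : Fin d) (x : ℝ) => Complex.exp (-(((θ i : ℂ) + (x : ℂ) * Complex.I) * (y i : ℂ))))]
  simp_rw [base1]
  split_ifs with h
  · subst h; simp
  · rw [mul_zero]
    obtain ⟨i, hi⟩ := Function.ne_iff.1 h
    exact Finset.prod_eq_zero (Finset.mem_univ i) (by simpa using hi)

lemma cont_wv {d : ℕ} (θ : Fin d → ℝ) (y : Fin d → ℤ) : Continuous fun ξ => dotc (wv θ ξ) y := by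
  unfold dotc wv; fun_prop

lemma cont_phat {d d₁ : ℕ} (l : Fin d₁ → Fin d → ℤ) (ρ : ℝ) (lam : Fin d₁ → ℝ) (θ : Fin d → ℝ) :
    Continuous fun ξ => phat l ρ lam (wv θ ξ) := by
  have := cont_wv θ
  unfold phat
  fun_prop

lemma rep {d d₁ : ℕ} (l : Fin d₁ → Fin d → ℤ) (ρ : ℝ) (lam : Fin d₁ → ℤ → ℝ)
    (G : ℤ → ℤ → (Fin d → ℤ) → ℝ)
    (h0 : ∀ (mm : ℤ) (y : Fin d → ℤ), G mm mm y = if y = 0 then 1 else 0)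
    (h1 : ∀ mm nn : ℤ, mm ≤ nn → ∀ y, G mm (nn + 1) y =
          G mm nn y + ρ * ∑ k, lam k nn * (G mm nn (y + l k) - 2 * G mm nn y + G mm nn (y - l k)))
    (θ : Fin d → ℝ) (j : ℤ) (T : ℕ) : ∀ y,
    (2 * (Real.pi : ℂ)) ^ d * (G j (j + T) y : ℂ) =
      ∫ ξ, Complex.exp (-dotc (wv θ ξ) y) *
        ∏ s ∈ Finset.range T, phat l ρ (fun k => lam k (j + s)) (wv θ ξ) ∂(tor d) := by
  have cw := cont_wv θ
  have cp := fun lam => cont_phat l ρ lam θ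
  induction T with
  | zero => intro y; simp [base_int, h0]; split_ifs <;> simp
  | succ T ih =>
    intro y
    have e : j + ((T + 1 : ℕ) : ℤ) = (j + T) + 1 := by push_cast; ring
    rw [e, h1 j (j + T) (by omega)]
    push_cast
    set P : (Fin d → ℝ) → ℂ := fun ξ => ∏ s ∈ Finset.range T, phat l ρ (fun k => lam k (j + s)) (wv θ ξ) with hP
    have cP : Continuous P := by rw [hP]; fun_prop
    have hint : ∀ y, Integrable (fun ξ => Complex.exp (-dotc (wv θ ξ) y) * P ξ) (tor d) :=
      fun y => tor_integrable (by fun_prop)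
    have e2 : (2 * (Real.pi : ℂ)) ^ d * ((G j (j + T) y : ℂ) + ρ * ∑ k, (lam k (j + T) : ℂ) *
        ((G j (j + T) (y + l k) : ℂ) - 2 * (G j (j + T) y : ℂ) + (G j (j + T) (y - l k) : ℂ)))
        = (2 * (Real.pi : ℂ)) ^ d * (G j (j + T) y : ℂ) + ρ * ∑ k, (lam k (j + T) : ℂ) *
        ((2 * (Real.pi : ℂ)) ^ d * (G j (j + T) (y + l k) : ℂ) - 2 * ((2 * (Real.pi : ℂ)) ^ d * (G j (j + T) y : ℂ)) + (2 * (Real.pi : ℂ)) ^ d * (G j (j + T) (y - l k) : ℂ)) := by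
      rw [mul_add, Finset.mul_sum, Finset.mul_sum, Finset.mul_sum]
      congr 1
      exact Finset.sum_congr rfl fun k _ => by ring
    rw [e2]
    simp_rw [ih]
    have e3 : ∀ k, (lam k (j + T) : ℂ) * ((∫ ξ, Complex.exp (-dotc (wv θ ξ) (y + l k)) * P ξ ∂(tor d))
        - 2 * (∫ ξ, Complex.exp (-dotc (wv θ ξ) y) * P ξ ∂(tor d))
        + ∫ ξ, Complex.exp (-dotc (wv θ ξ) (y - l k)) * P ξ ∂(tor d))
        = ∫ ξ, (lam k (j + T) : ℂ) * (Complex.exp (-dotc (wv θ ξ) (y + l k)) * P ξ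
          - 2 * (Complex.exp (-dotc (wv θ ξ) y) * P ξ) + Complex.exp (-dotc (wv θ ξ) (y - l k)) * P ξ) ∂(tor d) := by
      intro k
      rw [integral_const_mul, integral_add, integral_sub, integral_const_mul]
      · exact hint _
      · exact (hint _).const_mul _
      · exact (hint _).sub ((hint _).const_mul _)
      · exact hint _
    change (∫ ξ, Complex.exp (-dotc (wv θ ξ) y) * P ξ ∂(tor d)) + ρ * ∑ k, (lam k (j + T) : ℂ) * ((∫ ξ, Complex.exp (-dotc (wv θ ξ) (y + l k)) * P ξ ∂(tor d))
        - 2 * (∫ ξ, Complex.exp (-dotc (wv θ ξ) y) * P ξ ∂(tor d))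
        + ∫ ξ, Complex.exp (-dotc (wv θ ξ) (y - l k)) * P ξ ∂(tor d)) = _
    have hk : ∀ k, Integrable (fun ξ => (lam k (j + T) : ℂ) * (Complex.exp (-dotc (wv θ ξ) (y + l k)) * P ξ
          - 2 * (Complex.exp (-dotc (wv θ ξ) y) * P ξ) + Complex.exp (-dotc (wv θ ξ) (y - l k)) * P ξ)) (tor d) :=
      fun k => tor_integrable (by fun_prop)
    rw [Finset.sum_congr rfl fun k _ => e3 k, ← integral_finsetSum _ fun k _ => hk k,
      ← integral_const_mul, ← integral_add (hint y)
        ((integrable_finsetSum _ fun k _ => hk k).const_mul _)]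
    congr 1
    funext ξ
    rw [Finset.prod_range_succ]
    change _ = Complex.exp (-dotc (wv θ ξ) y) * (P ξ * _)
    have : ∀ k, (lam k (j + T) : ℂ) * (Complex.exp (-dotc (wv θ ξ) (y + l k)) * P ξ
          - 2 * (Complex.exp (-dotc (wv θ ξ) y) * P ξ) + Complex.exp (-dotc (wv θ ξ) (y - l k)) * P ξ)
        = (Complex.exp (-dotc (wv θ ξ) y) * P ξ) * ((lam k (j + T) : ℂ) * (Complex.exp (-dotc (wv θ ξ) (l k)) - 2 + Complex.exp (dotc (wv θ ξ) (l k)))) := by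
      intro k
      rw [dotc_add, dotc_sub, neg_add, neg_sub, Complex.exp_add, sub_eq_add_neg (dotc _ (l k)), Complex.exp_add]
      ring
    rw [Finset.sum_congr rfl fun k _ => this k, ← Finset.mul_sum, phat]
    ring

lemma rep_L {d : ℕ} (θ : Fin d → ℝ) (f : (Fin d → ℤ) → ℝ) (Ψ : (Fin d → ℝ) → ℂ) (hΨ : Continuous Ψ) (K : ℂ)
    (hf : ∀ y, K * (f y : ℂ) = ∫ ξ, Complex.exp (-dotc (wv θ ξ) y) * Ψ ξ ∂(tor d))
    (ηs : List (Fin d → ℤ)) : ∀ y,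
    K * (Ldiff ηs f y : ℂ) = ∫ ξ, Complex.exp (-dotc (wv θ ξ) y) *
      ((ηs.map fun η => Complex.exp (-dotc (wv θ ξ) η) - 1).prod * Ψ ξ) ∂(tor d) := by
  have cw := cont_wv θ
  have cQ : ∀ ηs : List (Fin d → ℤ), Continuous fun ξ => (ηs.map fun η => Complex.exp (-dotc (wv θ ξ) η) - 1).prod := by
    intro ηs
    induction ηs with
    | nil => simpa using continuous_const
    | cons η ηs ih => simp only [List.map_cons, List.prod_cons]; fun_prop
  induction ηs with
  | nil => intro y; simpa [Ldiff] using hf y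
  | cons η ηs ih =>
    intro y
    have c := cQ ηs
    have e : Ldiff (η :: ηs) f y = Ldiff ηs f (y + η) - Ldiff ηs f y := rfl
    rw [e]
    push_cast
    rw [mul_sub, ih, ih, ← integral_sub (tor_integrable (by fun_prop)) (tor_integrable (by fun_prop))]
    congr 1
    funext ξ
    rw [dotc_add, neg_add, Complex.exp_add]
    simp only [List.map_cons, List.prod_cons]
    ring

lemma gauss_tor (d : ℕ) (b : ℝ) (hb : 0 < b) :
    Integrable (fun ξ : Fin d → ℝ => ∏ i, Real.exp (-b * ξ i ^ 2)) (tor d) ∧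
    ∫ ξ : Fin d → ℝ, ∏ i, Real.exp (-b * ξ i ^ 2) ∂(tor d) ≤ Real.sqrt (Real.pi / b) ^ d := by
  constructor
  · exact Integrable.fintype_prod (f := fun (_ : Fin d) (x : ℝ) => Real.exp (-b * x ^ 2))
      fun i => (integrable_exp_neg_mul_sq hb).restrict
  · rw [tor, integral_fintype_prod_eq_pow (𝕜 := ℝ) (fun x : ℝ => Real.exp (-b * x ^ 2)), Fintype.card_fin,
      ← integral_gaussian]
    refine pow_le_pow_left₀ (integral_nonneg fun x => (Real.exp_pos _).le) ?_ d
    exact setIntegral_le_integral (integrable_exp_neg_mul_sq hb)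
      (Filter.Eventually.of_forall fun x => (Real.exp_pos _).le)

lemma sinh_sq_le (b : ℝ) : Real.sinh b ^ 2 ≤ b ^ 2 * Real.exp (b ^ 2) := by
  have h1 := Real.cosh_sq b
  have h2 := Real.cosh_le_exp_half_sq b
  have h3 : Real.cosh b ^ 2 ≤ Real.exp (b ^ 2) := by
    have : Real.exp (b ^ 2) = Real.exp (b ^ 2 / 2) ^ 2 := by
      rw [← Real.exp_nat_mul]; congr 1; push_cast; ring
    rw [this]
    exact pow_le_pow_left₀ (Real.cosh_pos b).le h2 2
  have h4 := Real.add_one_le_exp (-(b ^ 2))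
  have h5 : Real.exp (-(b ^ 2)) * Real.exp (b ^ 2) = 1 := by rw [← Real.exp_add]; simp
  have h6 := mul_le_mul_of_nonneg_right h4 (Real.exp_pos (b ^ 2)).le
  nlinarith

lemma list_prod_bd {α : Type*} (f : α → ℂ) (K : ℝ) : ∀ L : List α, (∀ a ∈ L, ‖f a‖ ≤ K) →
    ‖(L.map f).prod‖ ≤ K ^ L.length := by
  intro L
  induction L with
  | nil => intro _; simp
  | cons a L ih =>
    intro h
    simp only [List.map_cons, List.prod_cons, List.length_cons, norm_mul]
    have h1 := h a (by simp)
    have h2 := ih fun b hb => h b (by simp [hb])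
    rw [pow_succ']
    exact mul_le_mul h1 h2 (norm_nonneg _) ((norm_nonneg _).trans h1)

lemma ptwise
    (d d₁ : ℕ) (hd : 1 ≤ d) (hdd₁ : d ≤ d₁)
    (l : Fin d₁ → Fin d → ℤ) (hl : ∀ (k : Fin d₁) (hk : (k : ℕ) < d), l k = stdE d ⟨k, hk⟩)
    (δ₁ δ₂ : ℝ) (hδ₁ : 0 < δ₁) (hδ₁₂ : δ₁ ≤ δ₂)
    (ρ : ℝ) (hρ : 0 < ρ) (hρ' : ρ < (2 * d₁ * δ₂)⁻¹)
    (m : ℕ) (η : Fin m → Fin d → ℤ) :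
    ∃ N : ℝ, 0 < N ∧
      ∀ lam : Fin d₁ → ℤ → ℝ, (∀ k t, lam k t ∈ Set.Icc δ₁ δ₂) →
      ∀ G : ℤ → ℤ → (Fin d → ℤ) → ℝ,
        (∀ (mm : ℤ) (y : Fin d → ℤ), G mm mm y = if y = 0 then 1 else 0) →
        (∀ mm nn : ℤ, mm ≤ nn → ∀ y, G mm (nn + 1) y =
          G mm nn y + ρ * ∑ k, lam k nn * (G mm nn (y + l k) - 2 * G mm nn y + G mm nn (y - l k))) →
      ∀ (j : ℤ) (T : ℕ), 1 ≤ T → ∀ y : Fin d → ℤ,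
        |Ldiff (List.ofFn η) (G j (j + T)) y| ≤
          N * (Real.sqrt T)⁻¹ ^ (m + d) * Real.exp (-((∑ i, |(y i : ℝ)|) * (Real.sqrt T)⁻¹)) := by
  obtain ⟨c, hc, hph⟩ := phat_bd hd hdd₁ l hl δ₁ δ₂ hδ₁ hδ₁₂ ρ hρ hρ'
  set B : ℝ := ∑ k, ∑ i, |(l k i : ℝ)| with hB
  set H : ℝ := 1 + ∑ k, ∑ i, |(η k i : ℝ)| with hH
  have hH0 : 1 ≤ H := by
    have : 0 ≤ ∑ k, ∑ i, |(η k i : ℝ)| := by positivity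
    linarith
  have hB0 : 0 ≤ B := by positivity
  set S : ℝ := B ^ 2 * Real.exp (B ^ 2) with hS
  set A : ℝ := Real.exp (H * (1 + d * Real.pi)) with hA
  set N0 : ℝ := (A * H) ^ m * (m.factorial * Real.exp (1 + d * (1 / (2 * c)) + S)) with hN0
  have hA0 : 0 < A := Real.exp_pos _
  have hN0p : 0 < N0 := by positivity
  refine ⟨N0 * Real.sqrt (Real.pi / (c / 2)) ^ d, by positivity, ?_⟩
  intro lam hlam G h0 h1 j T hT y
  have hTr : (1 : ℝ) ≤ T := by exact_mod_cast hT
  set t : ℝ := (Real.sqrt T)⁻¹ with ht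
  have hsq : 1 ≤ Real.sqrt T := Real.one_le_sqrt.2 hTr
  have ht0 : 0 < t := by positivity
  have ht1 : t ≤ 1 := inv_le_one_of_one_le₀ hsq
  have htT : T * t ^ 2 = 1 := by
    rw [ht, inv_pow, Real.sq_sqrt (by positivity)]; field_simp
  set θ : Fin d → ℝ := fun i => (Int.sign (y i) : ℝ) * t with hθ
  have hθt : ∀ i, |θ i| ≤ t := by
    intro i
    simp only [hθ, abs_mul, abs_of_pos ht0]
    have : |((Int.sign (y i) : ℤ) : ℝ)| ≤ 1 := by
      rcases lt_trichotomy (y i) 0 with h | h | h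
      · simp [Int.sign_eq_neg_one_of_neg h]
      · simp [h]
      · simp [Int.sign_eq_one_of_pos h]
    nlinarith
  have hθy : ∑ i, θ i * (y i : ℝ) = (∑ i, |(y i : ℝ)|) * t := by
    rw [Finset.sum_mul]
    refine Finset.sum_congr rfl fun i _ => ?_
    have : ((Int.sign (y i) : ℤ) : ℝ) * (y i : ℝ) = |(y i : ℝ)| := by
      exact_mod_cast Int.sign_mul_self_eq_abs (y i)
    simp only [hθ]
    rw [← this]; ring
  have hE : ∀ k, Real.sinh (∑ i, θ i * (l k i : ℝ)) ^ 2 ≤ t ^ 2 * S := by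
    intro k
    have hb : |∑ i, θ i * (l k i : ℝ)| ≤ t * B := by
      refine (Finset.abs_sum_le_sum_abs _ _).trans ?_
      have : ∑ i, |(l k i : ℝ)| ≤ B :=
        Finset.single_le_sum (f := fun k => ∑ i, |(l k i : ℝ)|) (fun k _ => by positivity) (Finset.mem_univ k)
      calc ∑ i, |θ i * (l k i : ℝ)| ≤ ∑ i, t * |(l k i : ℝ)| := by
            refine Finset.sum_le_sum fun i _ => ?_
            rw [abs_mul]; gcongr; exact hθt i
        _ = t * ∑ i, |(l k i : ℝ)| := by rw [Finset.mul_sum]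
        _ ≤ t * B := by gcongr
    set b := ∑ i, θ i * (l k i : ℝ)
    have hb2 : b ^ 2 ≤ t ^ 2 * B ^ 2 := by
      rw [← mul_pow, ← sq_abs]; gcongr
    have hb3 : b ^ 2 ≤ B ^ 2 := by
      refine hb2.trans ?_
      have : t ^ 2 ≤ 1 := by nlinarith
      nlinarith [sq_nonneg B]
    calc Real.sinh b ^ 2 ≤ b ^ 2 * Real.exp (b ^ 2) := sinh_sq_le b
      _ ≤ (t ^ 2 * B ^ 2) * Real.exp (B ^ 2) := by gcongr
      _ = t ^ 2 * S := by rw [hS]; ring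
  set P : (Fin d → ℝ) → ℂ := fun ξ => ∏ s ∈ Finset.range T, phat l ρ (fun k => lam k (j + s)) (wv θ ξ) with hP
  have cp := fun lam => cont_phat l ρ lam θ
  have cP : Continuous P := by rw [hP]; fun_prop
  have key := rep_L θ (G j (j + T)) P cP _ (rep l ρ lam G h0 h1 θ j T) (List.ofFn η) y
  have hPb : ∀ ξ : Fin d → ℝ, (∀ i, |ξ i| ≤ Real.pi) → ‖P ξ‖ ≤ Real.exp (-c * T * ∑ i, ξ i ^ 2 + S) := by
    intro ξ hξ
    have : ‖P ξ‖ ≤ ∏ _s ∈ Finset.range T, Real.exp (-c * ∑ i, ξ i ^ 2 + t ^ 2 * S) := by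
      rw [hP]; simp only [norm_prod]
      exact Finset.prod_le_prod (fun _ _ => norm_nonneg _)
        fun s _ => hph _ (fun k => hlam k _) θ ξ hξ _ hE
    refine this.trans (le_of_eq ?_)
    rw [Finset.prod_const, Finset.card_range, ← Real.exp_nat_mul]
    congr 1
    linear_combination S * htT
  have hLb : ∀ ξ : Fin d → ℝ, (∀ i, |ξ i| ≤ Real.pi) →
      ‖((List.ofFn η).map fun η => Complex.exp (-dotc (wv θ ξ) η) - 1).prod‖
        ≤ (A * H) ^ m * (t ^ m * (1 + (∑ i, |ξ i|) * t⁻¹) ^ m) := by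
    intro ξ hξ
    have hsum : ∑ i, |ξ i| ≤ d * Real.pi := by
      calc ∑ i, |ξ i| ≤ ∑ _i : Fin d, Real.pi := Finset.sum_le_sum fun i _ => hξ i
        _ = d * Real.pi := by simp
    have hX0 : 0 ≤ ∑ i, |ξ i| := by positivity
    have := list_prod_bd (fun η => Complex.exp (-dotc (wv θ ξ) η) - 1)
      ((A * H) * (t * (1 + (∑ i, |ξ i|) * t⁻¹))) (List.ofFn η) ?_
    · rw [List.length_ofFn, mul_pow, mul_pow t] at this
      exact this
    · intro a ha
      obtain ⟨k, rfl⟩ := (List.mem_ofFn' _ _).1 ha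
      have hz : ‖-dotc (wv θ ξ) (η k)‖ ≤ H * (t + ∑ i, |ξ i|) := by
        rw [norm_neg, dotc]
        refine (norm_sum_le _ _).trans ?_
        have h2 : ∑ i, |(η k i : ℝ)| ≤ H := by
          have := Finset.single_le_sum (f := fun k => ∑ i, |(η k i : ℝ)|) (fun k _ => by positivity) (Finset.mem_univ k)
          linarith
        calc ∑ i, ‖wv θ ξ i * (η k i : ℂ)‖ ≤ ∑ i, (t + ∑ i, |ξ i|) * |(η k i : ℝ)| := by
              refine Finset.sum_le_sum fun i _ => ?_
              rw [norm_mul]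
              have e1 : ‖((η k i : ℤ) : ℂ)‖ = |(η k i : ℝ)| := by simp
              rw [e1]
              gcongr
              rw [wv]
              refine (norm_add_le _ _).trans ?_
              rw [norm_mul, Complex.norm_I, mul_one, Complex.norm_real, Complex.norm_real]
              have := Finset.single_le_sum (f := fun i => |ξ i|) (fun k _ => abs_nonneg _) (Finset.mem_univ i)
              exact add_le_add (hθt i) this
          _ = (∑ i, |(η k i : ℝ)|) * (t + ∑ i, |ξ i|) := by rw [← Finset.mul_sum]; ring
          _ ≤ H * (t + ∑ i, |ξ i|) := by gcongr
      have hz2 : ‖-dotc (wv θ ξ) (η k)‖ ≤ H * (1 + d * Real.pi) := hz.trans (by gcongr)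
      have hn := Complex.norm_exp_sub_sum_le_norm_mul_exp (-dotc (wv θ ξ) (η k)) 1
      simp only [Finset.range_one, Finset.sum_singleton, pow_zero, Nat.factorial_zero, Nat.cast_one, div_one, pow_one] at hn
      refine hn.trans ?_
      have e : A * H * (t * (1 + (∑ i, |ξ i|) * t⁻¹)) = (H * (t + ∑ i, |ξ i|)) * A := by
        field_simp
      rw [e]
      have : Real.exp ‖-dotc (wv θ ξ) (η k)‖ ≤ A := Real.exp_le_exp.2 hz2
      gcongr
  have hfac : ∀ ξ : Fin d → ℝ, (1 + (∑ i, |ξ i|) * t⁻¹) ^ m ≤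
      m.factorial * Real.exp (1 + d * (1 / (2 * c)) + c / 2 * T * ∑ i, ξ i ^ 2) := by
    intro ξ
    have hs0 : 0 ≤ 1 + (∑ i, |ξ i|) * t⁻¹ := by positivity
    have := Real.pow_div_factorial_le_exp _ hs0 m
    rw [div_le_iff₀ (by positivity), mul_comm (Real.exp _)] at this
    refine this.trans (mul_le_mul_of_nonneg_left (Real.exp_le_exp.2 ?_) (by positivity))
    have : (∑ i, |ξ i|) * t⁻¹ ≤ ∑ i, (1 / (2 * c) + c / 2 * T * ξ i ^ 2) := by
      rw [Finset.sum_mul]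
      refine Finset.sum_le_sum fun i _ => ?_
      have hTt : (T : ℝ) = (t⁻¹) ^ 2 := by rw [inv_pow]; exact eq_inv_of_mul_eq_one_left htT
      rw [hTt, ← sq_abs (ξ i)]
      set q := |ξ i| * t⁻¹
      have : 1 / (2 * c) + c / 2 * t⁻¹ ^ 2 * |ξ i| ^ 2 - |ξ i| * t⁻¹ = (c * (|ξ i| * t⁻¹) - 1) ^ 2 / (2 * c) := by
        field_simp
        ring
      have h2 : 0 ≤ (c * (|ξ i| * t⁻¹) - 1) ^ 2 / (2 * c) := by positivity
      linarith
    rw [Finset.sum_add_distrib, ← Finset.mul_sum] at this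
    simp only [Finset.sum_const, Finset.card_univ, Fintype.card_fin, nsmul_eq_mul] at this
    linarith
  obtain ⟨gi, gb⟩ := gauss_tor d (c / 2 * T) (by positivity)
  set Y : ℝ := Real.exp (-((∑ i, |(y i : ℝ)|) * t)) with hY
  have hbound : ∀ᵐ ξ ∂(tor d), ‖Complex.exp (-dotc (wv θ ξ) y) *
      (((List.ofFn η).map fun η => Complex.exp (-dotc (wv θ ξ) η) - 1).prod * P ξ)‖
      ≤ (Y * t ^ m * N0) * ∏ i, Real.exp (-(c / 2 * T) * ξ i ^ 2) := by
    filter_upwards [tor_ae] with ξ hξ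
    rw [norm_mul, norm_mul]
    have e1 : ‖Complex.exp (-dotc (wv θ ξ) y)‖ = Y := by
      rw [Complex.norm_exp, dotc_wv, hθy, hY]
      simp
    rw [e1, ← Real.exp_sum, ← Finset.mul_sum]
    have hfx := hfac ξ
    calc Y * (‖((List.ofFn η).map fun η => Complex.exp (-dotc (wv θ ξ) η) - 1).prod‖ * ‖P ξ‖)
        ≤ Y * (((A * H) ^ m * (t ^ m * (m.factorial * Real.exp (1 + d * (1 / (2 * c)) + c / 2 * T * ∑ i, ξ i ^ 2)))) * Real.exp (-c * T * ∑ i, ξ i ^ 2 + S)) := by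
          have h1 := hLb ξ hξ
          have h2 := hPb ξ hξ
          have hY0 : 0 ≤ Y := (Real.exp_pos _).le
          refine mul_le_mul_of_nonneg_left (mul_le_mul (h1.trans ?_) h2 (norm_nonneg _) (by positivity)) hY0
          gcongr
      _ = Y * t ^ m * ((A * H) ^ m * m.factorial) * (Real.exp (1 + d * (1 / (2 * c)) + c / 2 * T * ∑ i, ξ i ^ 2) * Real.exp (-c * T * ∑ i, ξ i ^ 2 + S)) := by ring
      _ = Y * t ^ m * ((A * H) ^ m * m.factorial) * (Real.exp (1 + d * (1 / (2 * c)) + S) * Real.exp (-(c / 2 * T) * ∑ i, ξ i ^ 2)) := by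
          rw [← Real.exp_add, ← Real.exp_add]; congr 2; ring
      _ ≤ _ := le_of_eq (by rw [hN0]; ring)
  have hI := norm_integral_le_of_norm_le (gi.const_mul (Y * t ^ m * N0)) hbound
  rw [← key, integral_const_mul] at hI
  have hpi : (1 : ℝ) ≤ (2 * Real.pi) ^ d := one_le_pow₀ (by linarith [Real.pi_gt_three])
  have hn : ‖(2 * (Real.pi : ℂ)) ^ d * (Ldiff (List.ofFn η) (G j (j + T)) y : ℂ)‖
      = (2 * Real.pi) ^ d * |Ldiff (List.ofFn η) (G j (j + T)) y| := by
    rw [norm_mul, norm_pow, norm_mul, Complex.norm_real, Complex.norm_real, Real.norm_of_nonneg Real.pi_pos.le]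
    simp
  rw [hn] at hI
  have hsq2 : Real.sqrt (Real.pi / (c / 2 * T)) = Real.sqrt (Real.pi / (c / 2)) * t := by
    rw [← div_div, Real.sqrt_div (by positivity), ht]; rfl
  rw [hsq2, mul_pow] at gb
  have hY0 : 0 < Y := Real.exp_pos _
  calc |Ldiff (List.ofFn η) (G j (j + T)) y| ≤ (2 * Real.pi) ^ d * |Ldiff (List.ofFn η) (G j (j + T)) y| :=
        le_mul_of_one_le_left (abs_nonneg _) hpi
    _ ≤ _ := hI
    _ ≤ (Y * t ^ m * N0) * (Real.sqrt (Real.pi / (c / 2)) ^ d * t ^ d) := by gcongr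
    _ = _ := by ring

lemma supNat_le {d : ℕ} (z : Fin d → ℤ) (i : Fin d) : (z i).natAbs ≤ supNat z :=
  Finset.le_sup (f := fun i => (z i).natAbs) (Finset.mem_univ i)

lemma supNat_le_sum {d : ℕ} (z : Fin d → ℤ) : (supNat z : ℝ) ≤ ∑ i, |(z i : ℝ)| := by
  have : supNat z ≤ ∑ i, (z i).natAbs :=
    Finset.sup_le fun i _ => Finset.single_le_sum (f := fun i => (z i).natAbs) (fun _ _ => Nat.zero_le _) (Finset.mem_univ i)
  have h : (supNat z : ℝ) ≤ ((∑ i, (z i).natAbs : ℕ) : ℝ) := by exact_mod_cast this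
  refine h.trans (le_of_eq ?_)
  push_cast
  refine Finset.sum_congr rfl fun i _ => ?_
  rw [Nat.cast_natAbs]; simp

lemma maxX_bd {d : ℕ} (g : ℤ → (Fin d → ℤ) → ℝ) (j : ℤ) (S : Finset (Fin d → ℤ))
    (hS : ∀ z, g j z ≠ 0 → z ∈ S) (r : ℕ) (hr : 1 ≤ r) :
    ∑ z ∈ Cbox r 0, |g j z| ≤ (2 * (r : ℝ)) ^ d * maxX g j 0 := by
  have hbdd : BddAbove (Set.range fun r : ℕ+ =>
      (((2 * (r : ℕ) - 1 : ℕ) : ℝ) ^ d)⁻¹ * ∑ y ∈ Cbox (r : ℕ) (0 : Fin d → ℤ), |g j y|) := by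
    refine ⟨∑ z ∈ S, |g j z|, ?_⟩
    rintro _ ⟨r, rfl⟩
    have h1 : (1 : ℝ) ≤ ((2 * (r : ℕ) - 1 : ℕ) : ℝ) ^ d := by
      apply one_le_pow₀
      have := r.pos
      exact_mod_cast (by omega : 1 ≤ 2 * (r : ℕ) - 1)
    have h2 : ∑ y ∈ Cbox (r : ℕ) (0 : Fin d → ℤ), |g j y| ≤ ∑ z ∈ S, |g j z| := by
      rw [← Finset.sum_filter_ne_zero]
      refine Finset.sum_le_sum_of_subset_of_nonneg ?_ fun _ _ _ => abs_nonneg _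
      intro z hz
      exact hS z (by simpa using (Finset.mem_filter.1 hz).2)
    have h3 : (((2 * (r : ℕ) - 1 : ℕ) : ℝ) ^ d)⁻¹ ≤ 1 := inv_le_one_of_one_le₀ h1
    have h4 : 0 ≤ ∑ y ∈ Cbox (r : ℕ) (0 : Fin d → ℤ), |g j y| := by positivity
    exact (mul_le_of_le_one_left h4 h3).trans h2
  have h := le_ciSup hbdd (⟨r, hr⟩ : ℕ+)
  change (((2 * r - 1 : ℕ) : ℝ) ^ d)⁻¹ * ∑ y ∈ Cbox r (0 : Fin d → ℤ), |g j y| ≤ maxX g j 0 at h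
  have h1 : (0 : ℝ) < ((2 * r - 1 : ℕ) : ℝ) := by exact_mod_cast (by omega : 0 < 2 * r - 1)
  have h4 : 0 ≤ ∑ y ∈ Cbox r (0 : Fin d → ℤ), |g j y| := by positivity
  have hM : 0 ≤ maxX g j 0 := le_trans (by positivity) h
  rw [inv_mul_le_iff₀ (by positivity)] at h
  refine h.trans ?_
  gcongr
  exact_mod_cast (by omega : 2 * r - 1 ≤ 2 * r)

lemma maxX_sum (d : ℕ) : ∃ M : ℝ, 0 < M ∧ ∀ (g : ℤ → (Fin d → ℤ) → ℝ) (j : ℤ) (S : Finset (Fin d → ℤ)),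
    (∀ z, g j z ≠ 0 → z ∈ S) → ∀ T : ℕ, 1 ≤ T →
    ∑ z ∈ S, (Real.sqrt T)⁻¹ ^ d * Real.exp (-((∑ i, |(z i : ℝ)|) * (Real.sqrt T)⁻¹)) * |g j z|
      ≤ M * maxX g j 0 := by
  have hsum : Summable fun k : ℕ => ((k : ℝ) + 1) ^ d * Real.exp (-(k : ℝ)) := by
    have h := summable_pow_mul_geometric_of_norm_lt_one d (r := Real.exp (-1))
      (by rw [Real.norm_of_nonneg (Real.exp_pos _).le]; exact Real.exp_lt_one_iff.2 (by norm_num))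
    have h2 := ((summable_nat_add_iff 1).2 h).mul_left (Real.exp 1)
    refine h2.congr fun k => ?_
    rw [← Real.exp_nat_mul, mul_left_comm, ← Real.exp_add]
    push_cast
    congr 2; ring
  set M0 := ∑' k : ℕ, ((k : ℝ) + 1) ^ d * Real.exp (-(k : ℝ)) with hM0
  have hM0p : 0 ≤ M0 := tsum_nonneg fun k => by positivity
  refine ⟨4 ^ d * (M0 + 1), by positivity, ?_⟩
  intro g j S hS T hT
  have hTr : (1 : ℝ) ≤ T := by exact_mod_cast hT
  have hsq : 1 ≤ Real.sqrt T := Real.one_le_sqrt.2 hTr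
  set t : ℝ := (Real.sqrt T)⁻¹ with ht
  have ht0 : 0 < t := by positivity
  have htq : Real.sqrt T * t = 1 := by rw [ht]; field_simp
  set R : ℕ := ⌈Real.sqrt T⌉₊ with hR
  have hR1 : Real.sqrt T ≤ R := Nat.le_ceil _
  have hR2 : (R : ℝ) ≤ 2 * Real.sqrt T := by
    have := Nat.ceil_lt_add_one (a := Real.sqrt T) (by positivity)
    linarith
  have hR0 : 1 ≤ R := by exact_mod_cast (hsq.trans hR1)
  have hRt1 : 1 ≤ R * t := by rw [← htq]; gcongr
  have hRt2 : R * t ≤ 2 := by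
    have : (R : ℝ) * t ≤ 2 * Real.sqrt T * t := by gcongr
    nlinarith
  have hMx : 0 ≤ maxX g j 0 := by
    have := maxX_bd g j S hS 1 le_rfl
    have h0 : 0 ≤ ∑ z ∈ Cbox 1 (0 : Fin d → ℤ), |g j z| := by positivity
    have h2 : (0 : ℝ) < (2 * ((1 : ℕ) : ℝ)) ^ d := by positivity
    exact nonneg_of_mul_nonneg_right (h0.trans this) h2
  set κ : (Fin d → ℤ) → ℕ := fun z => supNat z / R with hκ
  have hbox : ∀ z, z ∈ Cbox ((κ z + 1) * R) (0 : Fin d → ℤ) := by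
    intro z
    have h1 : supNat z < (κ z + 1) * R := by
      have := Nat.lt_div_mul_add (a := supNat z) (b := R) (by omega)
      rw [add_mul, one_mul]; exact this
    rw [Cbox, Finset.mem_Icc]
    constructor <;> intro i <;> have := supNat_le z i <;> simp only [Pi.zero_apply] <;> omega
  have hexp : ∀ z : Fin d → ℤ, Real.exp (-((∑ i, |(z i : ℝ)|) * t)) ≤ Real.exp (-(κ z : ℝ)) := by
    intro z
    apply Real.exp_le_exp.2
    apply neg_le_neg
    have h1 : ((κ z * R : ℕ) : ℝ) ≤ supNat z := by exact_mod_cast Nat.div_mul_le_self _ _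
    have h2 := h1.trans (supNat_le_sum z)
    push_cast at h2
    calc (κ z : ℝ) ≤ κ z * (R * t) := le_mul_of_one_le_right (by positivity) hRt1
      _ = (κ z * R) * t := by ring
      _ ≤ _ := by gcongr
  calc ∑ z ∈ S, t ^ d * Real.exp (-((∑ i, |(z i : ℝ)|) * t)) * |g j z|
      ≤ ∑ z ∈ S, t ^ d * Real.exp (-(κ z : ℝ)) * |g j z| := by
        refine Finset.sum_le_sum fun z _ => ?_
        have := hexp z
        gcongr
    _ = ∑ k ∈ S.image κ, ∑ z ∈ S with κ z = k, t ^ d * Real.exp (-(κ z : ℝ)) * |g j z| :=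
        (Finset.sum_fiberwise_of_maps_to (fun z hz => Finset.mem_image_of_mem κ hz) _).symm
    _ ≤ ∑ k ∈ S.image κ, (4 ^ d * maxX g j 0) * (((k : ℝ) + 1) ^ d * Real.exp (-(k : ℝ))) := by
        refine Finset.sum_le_sum fun k _ => ?_
        have e1 : ∑ z ∈ S with κ z = k, t ^ d * Real.exp (-(κ z : ℝ)) * |g j z|
            = t ^ d * Real.exp (-(k : ℝ)) * ∑ z ∈ S with κ z = k, |g j z| := by
          rw [Finset.mul_sum]
          refine Finset.sum_congr rfl fun z hz => ?_
          rw [(Finset.mem_filter.1 hz).2]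
        have e2 : ∑ z ∈ S with κ z = k, |g j z| ≤ ∑ z ∈ Cbox ((k + 1) * R) 0, |g j z| := by
          refine Finset.sum_le_sum_of_subset_of_nonneg ?_ fun _ _ _ => abs_nonneg _
          intro z hz
          rw [← (Finset.mem_filter.1 hz).2]
          exact hbox z
        have e3 := maxX_bd g j S hS ((k + 1) * R) (Nat.mul_pos (Nat.succ_pos k) hR0)
        rw [e1]
        calc t ^ d * Real.exp (-(k : ℝ)) * ∑ z ∈ S with κ z = k, |g j z|
            ≤ t ^ d * Real.exp (-(k : ℝ)) * ((2 * (((k + 1) * R : ℕ) : ℝ)) ^ d * maxX g j 0) := by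
              gcongr; exact e2.trans e3
          _ = (2 * (R * t)) ^ d * maxX g j 0 * (((k : ℝ) + 1) ^ d * Real.exp (-(k : ℝ))) := by
              push_cast
              simp only [mul_pow]; ring
          _ ≤ (2 * 2) ^ d * maxX g j 0 * (((k : ℝ) + 1) ^ d * Real.exp (-(k : ℝ))) := by gcongr
          _ = _ := by norm_num
    _ = (4 ^ d * maxX g j 0) * ∑ k ∈ S.image κ, (((k : ℝ) + 1) ^ d * Real.exp (-(k : ℝ))) := by
        rw [Finset.mul_sum]
    _ ≤ (4 ^ d * maxX g j 0) * M0 := by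
        gcongr
        exact hsum.sum_le_tsum _ fun k _ => by positivity
    _ ≤ _ := by
        have : 0 ≤ 4 ^ d * maxX g j 0 := by positivity
        nlinarith

/-- Lemma 5.4: kernel estimate for large time separation `n - j ≥ r²`. -/
theorem kernel_estimate_time_separation
    (d d₁ : ℕ) (hd : 1 ≤ d) (hdd₁ : d ≤ d₁)
    (l : Fin d₁ → Fin d → ℤ) (hl : ∀ (k : Fin d₁) (hk : (k : ℕ) < d), l k = stdE d ⟨k, hk⟩)
    (δ₁ δ₂ : ℝ) (hδ₁ : 0 < δ₁) (hδ₁₂ : δ₁ ≤ δ₂)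
    (ρ : ℝ) (hρ : 0 < ρ) (hρ' : ρ < (2 * d₁ * δ₂)⁻¹)
    (m : ℕ) (hm : 1 ≤ m) (η : Fin m → Fin d → ℤ) :
    ∃ N : ℝ, 0 < N ∧
      ∀ lam : Fin d₁ → ℤ → ℝ, (∀ k t, lam k t ∈ Set.Icc δ₁ δ₂) →
      ∀ G : ℤ → ℤ → (Fin d → ℤ) → ℝ,
        (∀ (mm : ℤ) (y : Fin d → ℤ), G mm mm y = if y = 0 then 1 else 0) →
        (∀ mm nn : ℤ, mm ≤ nn → ∀ y, G mm (nn + 1) y =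
          G mm nn y + ρ * ∑ k, lam k nn * (G mm nn (y + l k) - 2 * G mm nn y + G mm nn (y - l k))) →
      ∀ r : ℕ, 1 ≤ r →
      ∀ (n : ℤ) (x : Fin d → ℤ), |n| < (r : ℤ) ^ 2 → (∀ i, |x i| < (r : ℤ)) →
      ∀ j : ℤ, j ≤ n - (r : ℤ) ^ 2 →
      ∀ g : ℤ → (Fin d → ℤ) → ℝ,
        (Function.support fun q : ℤ × (Fin d → ℤ) => g q.1 q.2).Finite →
        |∑' y : Fin d → ℤ, Ldiff (List.ofFn η) (G j n) y * g j (x - y)| ≤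
          N * ((n - j : ℤ) : ℝ) ^ (-(m : ℝ) / 2) * maxX g j 0 := by
  obtain ⟨N1, hN1, hpt⟩ := ptwise d d₁ hd hdd₁ l hl δ₁ δ₂ hδ₁ hδ₁₂ ρ hρ hρ' m η
  obtain ⟨M, hM, hmax⟩ := maxX_sum d
  refine ⟨N1 * Real.exp d * M, by positivity, ?_⟩
  intro lam hlam G h0 h1 r hr n x _ hx j hj g hg
  obtain ⟨T, hT⟩ : ∃ T : ℕ, n - j = T := ⟨(n - j).toNat, by
    have : (0 : ℤ) ≤ (r : ℤ) ^ 2 := by positivity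
    omega⟩
  have hn : n = j + T := by omega
  have hrT : r ^ 2 ≤ T := by
    have : ((r ^ 2 : ℕ) : ℤ) ≤ T := by push_cast; omega
    exact_mod_cast this
  have hT1 : 1 ≤ T := le_trans (Nat.one_le_pow _ _ hr) hrT
  have hTr : (1 : ℝ) ≤ T := by exact_mod_cast hT1
  have hpt' := hpt lam hlam G h0 h1 j T hT1
  rw [hT, hn]
  have hgj : (Function.support (g j)).Finite := by
    refine (hg.image Prod.snd).subset ?_
    intro z hz
    exact ⟨(j, z), hz, rfl⟩
  set S := hgj.toFinset with hSdef
  have hS : ∀ z, g j z ≠ 0 → z ∈ S := fun z hz => by simpa [hSdef] using hz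
  have hmx := hmax g j S hS T hT1
  have htT : ((T : ℤ) : ℝ) ^ (-(m : ℝ) / 2) = (Real.sqrt T)⁻¹ ^ m := by
    rw [Int.cast_natCast, ← Real.rpow_natCast, Real.sqrt_eq_rpow, ← Real.rpow_neg (by positivity),
      ← Real.rpow_mul (by positivity)]
    congr 1; ring
  rw [htT]
  have hsq : 1 ≤ Real.sqrt T := Real.one_le_sqrt.2 hTr
  set t : ℝ := (Real.sqrt T)⁻¹ with ht
  have ht0 : 0 < t := by positivity
  have hrt : (r : ℝ) * t ≤ 1 := by
    have : (r : ℝ) ≤ Real.sqrt T := Real.le_sqrt_of_sq_le (by exact_mod_cast hrT)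
    rw [ht, ← div_eq_mul_inv]; exact div_le_one_of_le₀ this (by positivity)
  have e1 : ∑' y : Fin d → ℤ, Ldiff (List.ofFn η) (G j (j + T)) y * g j (x - y)
      = ∑ z ∈ S, Ldiff (List.ofFn η) (G j (j + T)) (x - z) * g j z := by
    rw [← (Equiv.subLeft x).tsum_eq, tsum_eq_sum (s := S)]
    · exact Finset.sum_congr rfl fun z _ => by simp
    · intro z hz
      have : g j z = 0 := by
        by_contra h; exact hz (hS z h)
      simp [this]
  rw [e1]
  calc |∑ z ∈ S, Ldiff (List.ofFn η) (G j (j + T)) (x - z) * g j z|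
      ≤ ∑ z ∈ S, (N1 * Real.exp d * t ^ m) * (t ^ d * Real.exp (-((∑ i, |(z i : ℝ)|) * t)) * |g j z|) := by
        refine (Finset.abs_sum_le_sum_abs _ _).trans (Finset.sum_le_sum fun z _ => ?_)
        rw [abs_mul]
        have h2 : Real.exp (-((∑ i, |((x - z) i : ℝ)|) * t)) ≤ Real.exp d * Real.exp (-((∑ i, |(z i : ℝ)|) * t)) := by
          rw [← Real.exp_add]
          apply Real.exp_le_exp.2
          have h3 : ∑ i, |(z i : ℝ)| ≤ ∑ i, (|((x - z) i : ℝ)| + r) := by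
            refine Finset.sum_le_sum fun i _ => ?_
            have hxi : |(x i : ℝ)| ≤ r := by exact_mod_cast (hx i).le
            have : (z i : ℝ) = x i - ((x - z) i : ℤ) := by simp
            rw [this]
            refine (abs_sub _ _).trans ?_
            linarith
          rw [Finset.sum_add_distrib] at h3
          simp only [Finset.sum_const, Finset.card_univ, Fintype.card_fin, nsmul_eq_mul] at h3
          have h4 := mul_le_mul_of_nonneg_right h3 ht0.le
          have h5 : (d : ℝ) * (r * t) ≤ d * 1 := by gcongr
          nlinarith
        calc |Ldiff (List.ofFn η) (G j (j + T)) (x - z)| * |g j z|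
            ≤ (N1 * t ^ (m + d) * (Real.exp d * Real.exp (-((∑ i, |(z i : ℝ)|) * t)))) * |g j z| := by
              gcongr
              refine (hpt' (x - z)).trans ?_
              gcongr
          _ = _ := by ring
    _ = (N1 * Real.exp d * t ^ m) * ∑ z ∈ S, t ^ d * Real.exp (-((∑ i, |(z i : ℝ)|) * t)) * |g j z| := by
        rw [Finset.mul_sum]
    _ ≤ (N1 * Real.exp d * t ^ m) * (M * maxX g j 0) := by gcongr
    _ = _ := by ring
end
end

section
/- (Fourier transform of the discrete heat kernel.) Let d₁≥1 be an integer, ρ>0, l₁,…,l_{d₁}∈ℤ^d, and let λ₁,…,λ_{d₁} : ℤ→ℝ be nonnegative functions with 2ρΣ_{k=1}^{d₁}λ_k(t)≤1 for every t∈ℤ; let G be the associated discrete heat kernel. Then for all integers m<n, the function G(m,n,·) is finitely supported on ℤ^d and for every ξ∈ℝ^d its Fourier transform satisfies ℱG(m,n,·)(ξ) = Π_{j=m}^{n−1} ( 1 − 2ρ Σ_{k=1}^{d₁} λ_k(j)(1−cos(ξ·l_k)) ). -/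
open scoped ENNReal BigOperators

noncomputable section

/-- Lemma 11.1 (ii): Fourier transform of the discrete heat kernel. -/
theorem heat_kernel_fourier_transform
    (d d₁ : ℕ) (hd₁ : 1 ≤ d₁) (ρ : ℝ) (hρ : 0 < ρ)
    (l : Fin d₁ → Fin d → ℤ)
    (lam : Fin d₁ → ℤ → ℝ) (hlam : ∀ k t, 0 ≤ lam k t)
    (hlam' : ∀ t : ℤ, 2 * ρ * ∑ k, lam k t ≤ 1)
    (G : ℤ → ℤ → (Fin d → ℤ) → ℝ)
    (hG0 : ∀ (m : ℤ) (y : Fin d → ℤ), G m m y = if y = 0 then 1 else 0)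
    (hGrec : ∀ m nn : ℤ, m ≤ nn → ∀ y, G m (nn + 1) y =
      G m nn y + ρ * ∑ k, lam k nn * (G m nn (y + l k) - 2 * G m nn y + G m nn (y - l k))) :
    ∀ m nn : ℤ, m < nn →
      (Function.support (G m nn)).Finite ∧
      ∀ ξ : Fin d → ℝ,
        ∑' x : Fin d → ℤ,
            Complex.exp (-(Complex.I * ((∑ i, ξ i * (x i : ℝ) : ℝ) : ℂ))) * ((G m nn x : ℝ) : ℂ) =
          (((∏ j ∈ Finset.Ico m nn,
              (1 - 2 * ρ * ∑ k, lam k j * (1 - Real.cos (∑ i, ξ i * (l k i : ℝ))))) : ℝ) : ℂ) := by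
  have key : ∀ m nn : ℤ, m ≤ nn →
      (Function.support (G m nn)).Finite ∧
      ∀ ξ : Fin d → ℝ,
        HasSum (fun x : Fin d → ℤ =>
            Complex.exp (-(Complex.I * ((∑ i, ξ i * (x i : ℝ) : ℝ) : ℂ))) * ((G m nn x : ℝ) : ℂ))
          (((∏ j ∈ Finset.Ico m nn,
              (1 - 2 * ρ * ∑ k, lam k j * (1 - Real.cos (∑ i, ξ i * (l k i : ℝ))))) : ℝ) : ℂ) := by
    intro m nn hmn
    induction nn, hmn using Int.leInduction with
    | base =>
      refine ⟨(Set.finite_singleton (0 : Fin d → ℤ)).subset ?_, ?_⟩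
      · intro y hy
        by_contra h
        apply hy
        rw [hG0, if_neg (by simpa using h)]
      · intro ξ
        have h := hasSum_single (f := fun x : Fin d → ℤ =>
            Complex.exp (-(Complex.I * ((∑ i, ξ i * (x i : ℝ) : ℝ) : ℂ))) * ((G m m x : ℝ) : ℂ)) 0
          (by intro y hy; simp [hG0, hy])
        simpa [hG0] using h
    | succ nn hmn ih =>
      obtain ⟨hfin, hsum⟩ := ih
      refine ⟨?_, ?_⟩
      · have hU : (Function.support (G m nn) ∪ ⋃ k, (((fun y => y + l k) ⁻¹' Function.support (G m nn)) ∪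
            ((fun y => y - l k) ⁻¹' Function.support (G m nn)))).Finite := by
          refine hfin.union (Set.finite_iUnion fun k => ?_)
          exact (hfin.preimage (add_left_injective (l k)).injOn).union
            (hfin.preimage (sub_left_injective (b := l k)).injOn)
        refine hU.subset ?_
        intro y hy
        by_contra h
        apply hy
        simp only [Set.mem_union, Set.mem_iUnion, Set.mem_preimage, Function.mem_support,
          not_or, not_exists, not_not] at h
        rw [hGrec m nn hmn, h.1]
        simp [h.2]
      · intro ξ
        have h0 := hsum ξ
        set P : ℝ := ∏ j ∈ Finset.Ico m nn,
              (1 - 2 * ρ * ∑ k, lam k j * (1 - Real.cos (∑ i, ξ i * (l k i : ℝ)))) with hP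
        have hshift : ∀ v : Fin d → ℤ, HasSum (fun x : Fin d → ℤ =>
            Complex.exp (-(Complex.I * ((∑ i, ξ i * (x i : ℝ) : ℝ) : ℂ))) *
              ((G m nn (x + v) : ℝ) : ℂ))
            (Complex.exp (Complex.I * ((∑ i, ξ i * (v i : ℝ) : ℝ) : ℂ)) * (P : ℂ)) := by
          intro v
          have h1 := ((Equiv.addRight v).hasSum_iff.mpr h0).mul_left
            (Complex.exp (Complex.I * ((∑ i, ξ i * (v i : ℝ) : ℝ) : ℂ)))
          refine h1.congr_fun ?_
          intro x
          simp only [Function.comp, Equiv.coe_addRight]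
          rw [← mul_assoc, ← Complex.exp_add]
          congr 2
          simp only [Pi.add_apply, Int.cast_add, mul_add, Finset.sum_add_distrib, Complex.ofReal_add]
          ring
        have hall := h0.add ((hasSum_sum (s := Finset.univ) fun k _ =>
          (((hshift (l k)).sub (h0.mul_left 2)).add (hshift (-l k))).mul_left
            ((lam k nn : ℝ) : ℂ)).mul_left (ρ : ℂ))
        have hI : Finset.Ico m (nn + 1) = insert nn (Finset.Ico m nn) := by
          ext j; simp only [Finset.mem_Ico, Finset.mem_insert]; omega
        rw [hI, Finset.prod_insert (by simp), ← hP]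
        convert hall using 1
        · funext x
          rw [hGrec m nn hmn]
          generalize Complex.exp (-(Complex.I * ((∑ i, ξ i * (x i : ℝ) : ℝ) : ℂ))) = E
          push_cast
          rw [mul_add, mul_left_comm, Finset.mul_sum]
          congr 1
          congr 1
          refine Finset.sum_congr rfl fun k _ => ?_
          rw [← sub_eq_add_neg]
          ring
        · have hc : ∀ k, Complex.exp (Complex.I * ((∑ i, ξ i * (l k i : ℝ) : ℝ) : ℂ)) +
              Complex.exp (Complex.I * ((∑ i, ξ i * (((-l k) i : ℤ) : ℝ) : ℝ) : ℂ)) =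
              2 * ((Real.cos (∑ i, ξ i * (l k i : ℝ)) : ℝ) : ℂ) := by
            intro k
            have : (∑ i, ξ i * (((-l k) i : ℤ) : ℝ) : ℝ) = - ∑ i, ξ i * (l k i : ℝ) := by
              simp
            rw [this, Complex.ofReal_cos, Complex.two_cos]
            push_cast
            congr 2 <;> ring
          have hs : ∀ k, (lam k nn : ℂ) *
              (Complex.exp (Complex.I * ((∑ i, ξ i * (l k i : ℝ) : ℝ) : ℂ)) * (P : ℂ) - 2 * P +
              Complex.exp (Complex.I * ((∑ i, ξ i * (((-l k) i : ℤ) : ℝ) : ℝ) : ℂ)) * P) =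
              ((lam k nn * (1 - Real.cos (∑ i, ξ i * (l k i : ℝ))) : ℝ) : ℂ) * (-2 * P) := by
            intro k
            rw [Complex.ofReal_mul, Complex.ofReal_sub, Complex.ofReal_one]
            linear_combination (lam k nn : ℂ) * P * hc k
          rw [Finset.sum_congr rfl fun k _ => hs k, ← Finset.sum_mul, ← Complex.ofReal_sum]
          generalize (∑ k, lam k nn * (1 - Real.cos (∑ i, ξ i * (l k i : ℝ)))) = S
          push_cast
          ring
  intro m nn h
  exact ⟨(key m nn h.le).1, fun ξ => ((key m nn h.le).2 ξ).tsum_eq⟩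
end
end

section
/- (Gaussian tail bound for the discrete heat kernel.) Let d₁≥1 be an integer, ρ>0, l₁,…,l_{d₁}∈ℤ^d, and let λ₁,…,λ_{d₁} : ℤ→ℝ be nonnegative functions with 2ρΣ_{k=1}^{d₁}λ_k(t)≤1 for every t∈ℤ; let G be the associated discrete heat kernel. Then there exists β>0, depending only on the vectors l₁,…,l_{d₁}, such that for all n,r∈ℕ: Σ_{x∈ℤ^d, ‖x‖≥r} G(0,n,x) ≤ 2d exp(−β r²/n). -/
open scoped ENNReal BigOperators

noncomputable section

theorem hk_nonneg {d d₁ : ℕ} (l : Fin d₁ → Fin d → ℤ) (ρ : ℝ) (hρ : 0 < ρ)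
    (lam : Fin d₁ → ℤ → ℝ) (h0 : ∀ k t, 0 ≤ lam k t) (h1 : ∀ t : ℤ, 2 * ρ * ∑ k, lam k t ≤ 1)
    (G : ℤ → ℤ → (Fin d → ℤ) → ℝ)
    (hG0 : ∀ (m : ℤ) (y : Fin d → ℤ), G m m y = if y = 0 then 1 else 0)
    (hG : ∀ m nn : ℤ, m ≤ nn → ∀ y, G m (nn + 1) y =
          G m nn y + ρ * ∑ k, lam k nn * (G m nn (y + l k) - 2 * G m nn y + G m nn (y - l k)))
    (n : ℕ) : ∀ x, 0 ≤ G 0 n x := by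
  induction n with
  | zero => intro x; simp only [Nat.cast_zero, hG0]; split_ifs <;> norm_num
  | succ n ih =>
    intro x
    push_cast
    rw [hG 0 n (by positivity) x]
    have e : G 0 n x + ρ * ∑ k, lam k n * (G 0 n (x + l k) - 2 * G 0 n x + G 0 n (x - l k))
        = (1 - 2 * ρ * ∑ k, lam k n) * G 0 n x
          + ρ * ∑ k, lam k n * (G 0 n (x + l k) + G 0 n (x - l k)) := by
      have : ∑ k, lam k n * (G 0 n (x + l k) - 2 * G 0 n x + G 0 n (x - l k))
        = ∑ k, lam k n * (G 0 n (x + l k) + G 0 n (x - l k)) - (∑ k, lam k n) * (2 * G 0 n x) := by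
        rw [Finset.sum_mul, ← Finset.sum_sub_distrib]
        exact Finset.sum_congr rfl fun k _ => by ring
      rw [this]; ring
    rw [e]
    have := h1 n
    have h2 : 0 ≤ ∑ k, lam k n * (G 0 n (x + l k) + G 0 n (x - l k)) :=
      Finset.sum_nonneg fun k _ => mul_nonneg (h0 _ _) (add_nonneg (ih _) (ih _))
    have h3 := mul_nonneg (sub_nonneg.2 this) (ih x)
    positivity

theorem hk_moment {d d₁ : ℕ} (l : Fin d₁ → Fin d → ℤ) (ρ : ℝ) (hρ : 0 < ρ)
    (lam : Fin d₁ → ℤ → ℝ) (h0 : ∀ k t, 0 ≤ lam k t) (h1 : ∀ t : ℤ, 2 * ρ * ∑ k, lam k t ≤ 1)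
    (G : ℤ → ℤ → (Fin d → ℤ) → ℝ)
    (hG0 : ∀ (m : ℤ) (y : Fin d → ℤ), G m m y = if y = 0 then 1 else 0)
    (hG : ∀ m nn : ℤ, m ≤ nn → ∀ y, G m (nn + 1) y =
          G m nn y + ρ * ∑ k, lam k nn * (G m nn (y + l k) - 2 * G m nn y + G m nn (y - l k)))
    (C : ℝ) (hC : ∀ k i, ((l k i : ℤ) : ℝ) ^ 2 ≤ C) (hC0 : 0 ≤ C)
    (i : Fin d) (θ : ℝ) (n : ℕ) :
    ∃ M : ℝ, HasSum (fun x => G 0 n x * Real.exp (θ * x i)) M ∧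
      M ≤ Real.exp (n * (θ ^ 2 * C / 2)) := by
  induction n with
  | zero =>
    refine ⟨1, ?_, by simp⟩
    have := hasSum_single (f := fun x : Fin d → ℤ => G 0 (0 : ℕ) x * Real.exp (θ * x i)) 0
      (by intro x hx; simp [hG0, hx])
    simpa [hG0] using this
  | succ n ih =>
    obtain ⟨M, hM, hMle⟩ := ih
    have hM0 : 0 ≤ M := hM.nonneg fun x =>
      mul_nonneg (hk_nonneg l ρ hρ lam h0 h1 G hG0 hG n x) (Real.exp_pos _).le
    have hplus : ∀ v : Fin d → ℤ, HasSum (fun x => G 0 n (x + v) * Real.exp (θ * x i))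
        (Real.exp (-(θ * v i)) * M) := by
      intro v
      have h := ((Equiv.addRight v).hasSum_iff.2 hM).mul_left (Real.exp (-(θ * v i)))
      refine (congrArg (fun f => HasSum f (Real.exp (-(θ * v i)) * M)) (funext fun x => ?_)).mpr h
      simp only [Function.comp, Equiv.coe_addRight, Pi.add_apply]
      rw [mul_left_comm, ← Real.exp_add]
      push_cast
      ring_nf
    have hminus : ∀ v : Fin d → ℤ, HasSum (fun x => G 0 n (x - v) * Real.exp (θ * x i))
        (Real.exp (θ * v i) * M) := by
      intro v
      simpa [sub_eq_add_neg] using hplus (-v)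
    have key := hM.add ((hasSum_sum (s := Finset.univ) fun k _ =>
      (((hplus (l k)).sub (hM.mul_left 2)).add (hminus (l k))).mul_left (lam k n)).mul_left ρ)
    refine ⟨_, (congrArg (fun f => HasSum f _) (funext fun x => ?_)).mpr key, ?_⟩
    · show G 0 ((n + 1 : ℕ) : ℤ) x * Real.exp (θ * x i) = _
      push_cast
      rw [hG 0 n (by positivity) x, add_mul, mul_assoc, Finset.sum_mul]
      congr 2
      exact Finset.sum_congr rfl fun k _ => by ring
    · set E := Real.exp (θ ^ 2 * C / 2) with hE
      have hE1 : 1 ≤ E := Real.one_le_exp (by positivity)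
      have hk : ∀ k, Real.exp (-(θ * l k i)) + Real.exp (θ * l k i) ≤ 2 * E := by
        intro k
        have h := Real.cosh_le_exp_half_sq (θ * l k i)
        have h2 : Real.exp ((θ * l k i) ^ 2 / 2) ≤ E := by
          apply Real.exp_le_exp.2
          rw [mul_pow]
          have := hC k i
          gcongr
        rw [Real.cosh_eq] at h
        linarith
      have hs : ∑ k, lam k n * (Real.exp (-(θ * l k i)) * M - 2 * M + Real.exp (θ * l k i) * M)
          ≤ ∑ k, lam k n * (2 * (E - 1) * M) := by
        apply Finset.sum_le_sum
        intro k _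
        apply mul_le_mul_of_nonneg_left _ (h0 _ _)
        nlinarith [mul_le_mul_of_nonneg_right (hk k) hM0]
      rw [← Finset.sum_mul] at hs
      have h3 := mul_le_mul_of_nonneg_left hs hρ.le
      have h4 := mul_le_mul_of_nonneg_right (h1 n) (mul_nonneg (sub_nonneg.2 hE1) hM0)
      have h5 : M + ρ * ∑ k, lam k n *
          (Real.exp (-(θ * l k i)) * M - 2 * M + Real.exp (θ * l k i) * M) ≤ E * M := by
        nlinarith
      refine h5.trans ?_
      push_cast
      rw [add_mul, one_mul, Real.exp_add, mul_comm]
      exact mul_le_mul_of_nonneg_right hMle (Real.exp_pos _).le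

theorem hk_tail {d d₁ : ℕ} (l : Fin d₁ → Fin d → ℤ) (ρ : ℝ) (hρ : 0 < ρ)
    (lam : Fin d₁ → ℤ → ℝ) (h0 : ∀ k t, 0 ≤ lam k t) (h1 : ∀ t : ℤ, 2 * ρ * ∑ k, lam k t ≤ 1)
    (G : ℤ → ℤ → (Fin d → ℤ) → ℝ)
    (hG0 : ∀ (m : ℤ) (y : Fin d → ℤ), G m m y = if y = 0 then 1 else 0)
    (hG : ∀ m nn : ℤ, m ≤ nn → ∀ y, G m (nn + 1) y =
          G m nn y + ρ * ∑ k, lam k nn * (G m nn (y + l k) - 2 * G m nn y + G m nn (y - l k)))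
    (C : ℝ) (hC : ∀ k i, ((l k i : ℤ) : ℝ) ^ 2 ≤ C) (hC0 : 0 ≤ C)
    (i : Fin d) (θ a : ℝ) (n : ℕ) :
    (∑' x, ENNReal.ofReal (G 0 n x * Real.exp (θ * x i) * Real.exp (-a))) ≤
      ENNReal.ofReal (Real.exp (n * (θ ^ 2 * C / 2) - a)) := by
  obtain ⟨M, hM, hle⟩ := hk_moment l ρ hρ lam h0 h1 G hG0 hG C hC hC0 i θ n
  have h := hM.mul_right (Real.exp (-a))
  rw [← ENNReal.ofReal_tsum_of_nonneg _ h.summable, h.tsum_eq, sub_eq_add_neg, Real.exp_add]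
  · exact ENNReal.ofReal_le_ofReal (mul_le_mul_of_nonneg_right hle (Real.exp_pos _).le)
  · intro x
    have := hk_nonneg l ρ hρ lam h0 h1 G hG0 hG n x
    positivity

/-- Lemma 11.4: Gaussian tail bound for the discrete heat kernel. -/
theorem heat_kernel_gaussian_tail
    (d d₁ : ℕ) (hd₁ : 1 ≤ d₁)
    (l : Fin d₁ → Fin d → ℤ) :
    ∃ β : ℝ, 0 < β ∧
      ∀ ρ : ℝ, 0 < ρ →
      ∀ lam : Fin d₁ → ℤ → ℝ, (∀ k t, 0 ≤ lam k t) → (∀ t : ℤ, 2 * ρ * ∑ k, lam k t ≤ 1) →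
      ∀ G : ℤ → ℤ → (Fin d → ℤ) → ℝ,
        (∀ (m : ℤ) (y : Fin d → ℤ), G m m y = if y = 0 then 1 else 0) →
        (∀ m nn : ℤ, m ≤ nn → ∀ y, G m (nn + 1) y =
          G m nn y + ρ * ∑ k, lam k nn * (G m nn (y + l k) - 2 * G m nn y + G m nn (y - l k))) →
      ∀ n r : ℕ, 1 ≤ n → 1 ≤ r →
        (∑' x : Fin d → ℤ, if r ≤ supNat x then ENNReal.ofReal (G 0 n x) else 0) ≤
          ENNReal.ofReal (2 * d * Real.exp (-β * r ^ 2 / n)) := by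
  set C : ℝ := 1 + ∑ k, ∑ i, ((l k i : ℤ) : ℝ) ^ 2 with hCdef
  have hCpos : 0 < C := by positivity
  have hC : ∀ k i, ((l k i : ℤ) : ℝ) ^ 2 ≤ C := by
    intro k i
    have a1 : ((l k i : ℤ) : ℝ) ^ 2 ≤ ∑ i, ((l k i : ℤ) : ℝ) ^ 2 :=
      Finset.single_le_sum (f := fun i => ((l k i : ℤ) : ℝ) ^ 2)
        (fun _ _ => sq_nonneg _) (Finset.mem_univ i)
    have a2 : ∑ i, ((l k i : ℤ) : ℝ) ^ 2 ≤ ∑ k, ∑ i, ((l k i : ℤ) : ℝ) ^ 2 :=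
      Finset.single_le_sum (f := fun k => ∑ i, ((l k i : ℤ) : ℝ) ^ 2)
        (fun _ _ => Finset.sum_nonneg fun _ _ => sq_nonneg _) (Finset.mem_univ k)
    linarith
  refine ⟨1 / (2 * C), by positivity, ?_⟩
  intro ρ hρ lam h0 h1 G hG0 hG n r hn hr
  have hn' : (0 : ℝ) < n := by exact_mod_cast hn
  set θ : ℝ := r / (n * C) with hθ
  have hθ0 : 0 ≤ θ := by positivity
  have hnn := hk_nonneg l ρ hρ lam h0 h1 G hG0 hG n
  have hexp : (n : ℝ) * (θ ^ 2 * C / 2) - θ * r = -(1 / (2 * C)) * r ^ 2 / n := by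
    rw [hθ]; field_simp; ring
  have T1 := fun i => hk_tail l ρ hρ lam h0 h1 G hG0 hG C hC hCpos.le i θ (θ * r) n
  have T2 := fun i => hk_tail l ρ hρ lam h0 h1 G hG0 hG C hC hCpos.le i (-θ) (θ * r) n
  simp only [neg_sq, hexp] at T1 T2
  calc (∑' x : Fin d → ℤ, if r ≤ supNat x then ENNReal.ofReal (G 0 n x) else 0)
      ≤ ∑' x : Fin d → ℤ, ∑ i : Fin d,
          (ENNReal.ofReal (G 0 n x * Real.exp (θ * x i) * Real.exp (-(θ * r)))
          + ENNReal.ofReal (G 0 n x * Real.exp (-θ * x i) * Real.exp (-(θ * r)))) := by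
        apply ENNReal.tsum_le_tsum
        intro x
        split_ifs with hx
        swap
        · exact zero_le
        obtain ⟨i, -, hi⟩ := (Finset.le_sup_iff (by exact_mod_cast hr)).1 hx
        refine le_trans ?_ (Finset.single_le_sum (fun _ _ => zero_le) (Finset.mem_univ i))
        have aux : ∀ t : ℝ, θ * r ≤ t →
            G 0 n x ≤ G 0 n x * Real.exp t * Real.exp (-(θ * r)) := by
          intro t ht
          rw [mul_assoc, ← Real.exp_add]
          exact le_mul_of_one_le_right (hnn x) (Real.one_le_exp (by linarith))
        rcases le_total 0 (x i) with hs | hs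
        · refine le_trans (ENNReal.ofReal_le_ofReal (aux (θ * x i) ?_)) le_self_add
          apply mul_le_mul_of_nonneg_left _ hθ0
          have : (r : ℤ) ≤ x i := by omega
          exact_mod_cast this
        · refine le_trans (ENNReal.ofReal_le_ofReal (aux (-θ * x i) ?_)) le_add_self
          rw [neg_mul_comm]
          apply mul_le_mul_of_nonneg_left _ hθ0
          have : (r : ℤ) ≤ - x i := by omega
          exact_mod_cast this
    _ = ∑ i : Fin d, ((∑' x : Fin d → ℤ,
          ENNReal.ofReal (G 0 n x * Real.exp (θ * x i) * Real.exp (-(θ * r))))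
          + ∑' x : Fin d → ℤ,
            ENNReal.ofReal (G 0 n x * Real.exp (-θ * x i) * Real.exp (-(θ * r)))) := by
        rw [Summable.tsum_finsetSum fun _ _ => ENNReal.summable]
        exact Finset.sum_congr rfl fun i _ => ENNReal.tsum_add
    _ ≤ ∑ i : Fin d, (ENNReal.ofReal (Real.exp (-(1 / (2 * C)) * r ^ 2 / n))
          + ENNReal.ofReal (Real.exp (-(1 / (2 * C)) * r ^ 2 / n))) :=
        Finset.sum_le_sum fun i _ => add_le_add (T1 i) (T2 i)
    _ = ENNReal.ofReal (2 * d * Real.exp (-(1 / (2 * C)) * r ^ 2 / n)) := by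
        rw [← ENNReal.ofReal_add (Real.exp_pos _).le (Real.exp_pos _).le,
          ← ENNReal.ofReal_sum_of_nonneg (fun _ _ => by positivity)]
        congr 1
        simp
        ring
end
end

section
/- Let g∈l₁(ℤ^d) and let f:ℤ^d→ℝ satisfy f(x)→0 as ‖x‖→∞. Then Σ_{x∈ℤ^d} |f(x)g(x)| ≤ Σ_{x∈ℤ^d} |δ_{e_1}⋯δ_{e_d} f(x)| · Σ_{y∈ℤ^d, ‖y‖≤‖x‖+1} |g(y)|. -/
open scoped ENNReal BigOperators

noncomputable section

open Filter in
lemma tele_aux (u : ℕ → ℝ) (hu : Tendsto u atTop (nhds 0)) :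
    ENNReal.ofReal |u 0| ≤ ∑' k, ENNReal.ofReal |u (k+1) - u k| := by
  have h1 : ∀ N, ENNReal.ofReal |u 0| ≤
      ENNReal.ofReal |u N| + ∑' k, ENNReal.ofReal |u (k+1) - u k| := by
    intro N
    refine le_trans ?_ (add_le_add le_rfl (ENNReal.sum_le_tsum (Finset.range N)))
    rw [← ENNReal.ofReal_sum_of_nonneg (fun _ _ => abs_nonneg _),
      ← ENNReal.ofReal_add (abs_nonneg _) (Finset.sum_nonneg fun _ _ => abs_nonneg _)]
    apply ENNReal.ofReal_le_ofReal
    have h2 := Finset.abs_sum_le_sum_abs (fun k => u (k+1) - u k) (Finset.range N)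
    rw [Finset.sum_range_sub] at h2
    have h3 := abs_sub_abs_le_abs_sub (u 0) (u N)
    rw [abs_sub_comm] at h3
    linarith
  have h2 : Tendsto (fun N => ENNReal.ofReal |u N| +
      ∑' k, ENNReal.ofReal |u (k+1) - u k|) atTop
      (nhds (ENNReal.ofReal |(0:ℝ)| + ∑' k, ENNReal.ofReal |u (k+1) - u k|)) :=
    (ENNReal.tendsto_ofReal hu.abs).add tendsto_const_nhds
  simpa using ge_of_tendsto' h2 h1

lemma Ldiff_tendsto {d : ℕ} (l : List (Fin d → ℤ)) (f : (Fin d → ℤ) → ℝ)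
    (hf : Filter.Tendsto f Filter.cofinite (nhds 0)) :
    Filter.Tendsto (Ldiff l f) Filter.cofinite (nhds 0) := by
  induction l with
  | nil => exact hf
  | cons a l ih =>
    have h := (ih.comp (add_left_injective a).tendsto_cofinite).sub ih
    simpa [Ldiff] using h

/-- outward step -/
def stp (a : ℤ) (k : ℕ) : ℤ := if 0 ≤ a then k else -((k : ℤ) + 1)

/-- region -/
def Reg {d : ℕ} (l : List (Fin d)) (x : Fin d → ℤ) : Set (Fin d → ℤ) :=
  {z | ∀ i, (i ∉ l → z i = x i) ∧ (0 ≤ x i → x i ≤ z i) ∧ (x i < 0 → z i ≤ x i)}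

lemma one_step {d : ℕ} (i : Fin d) (h : (Fin d → ℤ) → ℝ)
    (hh : Filter.Tendsto h Filter.cofinite (nhds 0)) (a : ℤ) (z : Fin d → ℤ) :
    ENNReal.ofReal |h z| ≤ ∑' k : ℕ,
      ENNReal.ofReal |h (z + stp a k • stdE d i + stdE d i) - h (z + stp a k • stdE d i)| := by
  by_cases ha : 0 ≤ a
  · have inj : Function.Injective fun k : ℕ => z + (k : ℤ) • stdE d i := by
      intro k m hkm
      have := congrFun hkm i
      simpa [stdE] using this
    have := tele_aux (fun k : ℕ => h (z + (k : ℤ) • stdE d i))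
      (by simpa only [Nat.cofinite_eq_atTop, Function.comp_def] using hh.comp inj.tendsto_cofinite)
    simp only [stp, ha, if_true]
    convert this using 6
    · simp
    · simp [add_smul, add_assoc]
  · have inj : Function.Injective fun k : ℕ => z + (-(k : ℤ)) • stdE d i := by
      intro k m hkm
      have := congrFun hkm i
      simpa [stdE] using this
    have := tele_aux (fun k : ℕ => h (z + (-(k : ℤ)) • stdE d i))
      (by simpa only [Nat.cofinite_eq_atTop, Function.comp_def] using hh.comp inj.tendsto_cofinite)
    simp only [stp, ha, if_false]
    refine le_trans (le_of_eq (by simp)) (this.trans (le_of_eq ?_))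
    refine tsum_congr fun k => ?_
    rw [abs_sub_comm]
    have e : z + (-((k : ℤ) + 1)) • stdE d i + stdE d i = z + (-(k : ℤ)) • stdE d i := by
      ext j; simp; ring
    rw [e]
    push_cast
    rfl

lemma main_ind {d : ℕ} (f : (Fin d → ℤ) → ℝ)
    (hf : Filter.Tendsto f Filter.cofinite (nhds 0)) (x : Fin d → ℤ) (l : List (Fin d))
    (hl : l.Nodup) :
    ENNReal.ofReal |f x| ≤ ∑' z : Reg l x, ENNReal.ofReal |Ldiff (l.map (stdE d)) f z| := by
  induction l with
  | nil =>
    have hx : x ∈ Reg [] x := fun i => by simp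
    exact ENNReal.le_tsum (f := fun z : Reg [] x =>
      ENNReal.ofReal |Ldiff (([] : List (Fin d)).map (stdE d)) f z|) ⟨x, hx⟩
  | cons i l ih =>
    obtain ⟨hi, hl⟩ := List.nodup_cons.1 hl
    refine (ih hl).trans ?_
    have h1 := fun z : Reg l x => one_step i _ (Ldiff_tendsto (l.map (stdE d)) f hf) (x i) z
    refine (ENNReal.tsum_le_tsum h1).trans ?_
    rw [← ENNReal.tsum_prod]
    let φ : Reg l x × ℕ → Reg (i :: l) x := fun p =>
      ⟨p.1 + stp (x i) p.2 • stdE d i, by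
        intro j
        have hz := p.1.2 j
        by_cases hj : j = i
        · subst hj
          have e := hz.1 hi
          simp only [List.mem_cons, true_or, not_true_eq_false, false_imp_iff, true_and]
          simp only [Pi.add_apply, Pi.smul_apply, stdE, e, stp]
          constructor <;> intro h
          · simp [h]
          · simp [not_le.2 h] <;> omega
        · simpa [stdE, hj] using hz⟩
    have hφ : Function.Injective φ := by
      rintro ⟨z, k⟩ ⟨w, m⟩ h
      have h' : z.1 + stp (x i) k • stdE d i = w.1 + stp (x i) m • stdE d i :=
        congrArg Subtype.val h
      have h2 := congrFun h' i
      have ez := (z.2 i).1 hi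
      have ew := (w.2 i).1 hi
      have hkm : k = m := by
        simp only [Pi.add_apply, Pi.smul_apply, ez, ew, stdE, stp] at h2
        split_ifs at h2 <;> simp at h2 <;> omega
      subst hkm
      have : z = w := Subtype.ext (add_right_cancel h')
      rw [this]
    exact ENNReal.tsum_comp_le_tsum_of_injective hφ
      (fun z : Reg (i :: l) x => ENNReal.ofReal |Ldiff ((i :: l).map (stdE d)) f z|)

lemma Reg_mem_Icc {d : ℕ} {l : List (Fin d)} {y z : Fin d → ℤ} (h : z ∈ Reg l y) :
    y ∈ Finset.Icc (fun _ : Fin d => -((supNat z : ℤ) + 1)) (fun _ => (supNat z : ℤ) + 1) := by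
  have h1 : ∀ i, (y i).natAbs ≤ supNat z := fun i => by
    have h2 : (z i).natAbs ≤ supNat z :=
      Finset.le_sup (f := fun i => (z i).natAbs) (Finset.mem_univ i)
    have := (h i).2
    omega
  rw [Finset.mem_Icc]
  constructor <;> intro i <;> have := h1 i <;> simp only <;> omega

/-- Lemma 9.5 (ii): discrete summation-by-parts estimate. -/
theorem discrete_summation_by_parts_estimate
    (d : ℕ) (hd : 1 ≤ d) (f g : (Fin d → ℤ) → ℝ)
    (hg : Summable fun x => |g x|)
    (hf : Filter.Tendsto f Filter.cofinite (nhds 0)) :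
    ∑' x : Fin d → ℤ, ENNReal.ofReal |f x * g x| ≤
      ∑' x : Fin d → ℤ,
        ENNReal.ofReal
          (|Ldiff (List.ofFn (stdE d)) f x| *
            ∑ y ∈ Finset.Icc (fun _ => -((supNat x : ℤ) + 1)) (fun _ => (supNat x : ℤ) + 1),
              |g y|) := by
  classical
  set D := Ldiff (List.ofFn (stdE d)) f with hD
  have hD' : D = Ldiff ((List.finRange d).map (stdE d)) f := by
    rw [hD, List.ofFn_eq_map]
  have h1 : ∀ y, ENNReal.ofReal |f y * g y| ≤ ∑' z,
      (Reg (List.finRange d) y).indicator (fun z => ENNReal.ofReal |D z|) z *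
        ENNReal.ofReal |g y| := by
    intro y
    rw [abs_mul, ENNReal.ofReal_mul (abs_nonneg _), ENNReal.tsum_mul_right, hD']
    have := main_ind f hf y (List.finRange d) (List.nodup_finRange d)
    rw [tsum_subtype (Reg (List.finRange d) y) (fun z =>
      ENNReal.ofReal |Ldiff ((List.finRange d).map (stdE d)) f z|)] at this
    gcongr
  refine (ENNReal.tsum_le_tsum h1).trans ?_
  rw [ENNReal.tsum_comm]
  refine ENNReal.tsum_le_tsum fun z => ?_
  rw [ENNReal.ofReal_mul (abs_nonneg _), ENNReal.ofReal_sum_of_nonneg (fun _ _ => abs_nonneg _),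
    Finset.mul_sum]
  rw [tsum_eq_sum (s := Finset.Icc (fun _ => -((supNat z : ℤ) + 1))
    (fun _ => (supNat z : ℤ) + 1))]
  · refine Finset.sum_le_sum fun y _ => ?_
    gcongr
    exact Set.indicator_le_self _ _ _
  · intro y hy
    rw [Set.indicator_of_notMem (fun h => hy (Reg_mem_Icc h)), zero_mul]
end
end

section
/- (Discrete parabolic Fefferman–Stein inequality.) Let d≥1 and p>1. There is a constant N depending only on p and d such that for every h:ℤ×ℤ^d→ℝ with Σ_{(t,x)∈ℤ×ℤ^d}|h(t,x)|^p<∞ one has Σ_{(t,x)∈ℤ×ℤ^d} |h(t,x)|^p ≤ N Σ_{(t,x)∈ℤ×ℤ^d} |h^{#}(t,x)|^p. -/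
open scoped ENNReal BigOperators

noncomputable section

/-- the parabolic box `Q_r(t,x) = ((t-r², t+r²) ∩ ℤ) × Π_i ((x^i-r, x^i+r) ∩ ℤ)`. -/
def Qbox (d : ℕ) (r : ℕ) (q : ℤ × (Fin d → ℤ)) : Finset (ℤ × (Fin d → ℤ)) :=
  Finset.Icc (q.1 - (r : ℤ) ^ 2 + 1) (q.1 + (r : ℤ) ^ 2 - 1) ×ˢ
    Finset.Icc (fun i => q.2 i - r + 1) (fun i => q.2 i + r - 1)

/-- the average `h_A = |A|⁻¹ Σ_{(t,x) ∈ A} |h(t,x)|`. -/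
noncomputable def avgAbs {d : ℕ} (h : ℤ → (Fin d → ℤ) → ℝ) (A : Finset (ℤ × (Fin d → ℤ))) : ℝ :=
  (A.card : ℝ)⁻¹ * ∑ q ∈ A, |h q.1 q.2|

/-- the parabolic sharp function
`h^#(t₀,x₀) = sup_{r ∈ ℕ} |Q_r|⁻¹ Σ_{(t,x) ∈ Q_r(t₀,x₀)} |h(t,x) - h_{Q_r(t₀,x₀)}|`. -/
noncomputable def sharp {d : ℕ} (h : ℤ → (Fin d → ℤ) → ℝ) (q : ℤ × (Fin d → ℤ)) : ℝ :=
  ⨆ r : ℕ+, ((Qbox d (r : ℕ) q).card : ℝ)⁻¹ *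
    ∑ p ∈ Qbox d (r : ℕ) q, |h p.1 p.2 - avgAbs h (Qbox d (r : ℕ) q)|

open scoped NNReal

structure Dya (X : Type) [DecidableEq X] (B : ℕ) where
  D : ℕ → X → Finset X
  self_mem : ∀ n q, q ∈ D n q
  eq_of_mem : ∀ n q q', q' ∈ D n q → D n q' = D n q
  card_eq : ∀ n q, (D n q).card = B ^ n
  mono : ∀ n q, D n q ⊆ D (n+1) q

namespace Dya
variable {X : Type} [DecidableEq X] {B : ℕ} (S : Dya X B)

lemma mem_symm {n : ℕ} {q q' : X} : q' ∈ S.D n q ↔ q ∈ S.D n q' := by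
  constructor
  · intro h; rw [S.eq_of_mem n q q' h]; exact S.self_mem n q
  · intro h; rw [S.eq_of_mem n q' q h]; exact S.self_mem n q'

lemma eq_of_le {n m : ℕ} (hnm : n ≤ m) {q q' : X} (h : q' ∈ S.D n q) : S.D m q' = S.D m q := by
  apply S.eq_of_mem
  induction m, hnm using Nat.le_induction with
  | base => exact h
  | succ m _ ih => exact S.mono m q ih

/-- averaging -/
noncomputable def E (f : X → ℝ≥0) (n : ℕ) (q : X) : ℝ≥0 := ((B : ℝ≥0) ^ n)⁻¹ * ∑ x ∈ S.D n q, f x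

/-- maximal -/
noncomputable def M (f : X → ℝ≥0) (L n : ℕ) (q : X) : ℝ≥0 :=
  (Finset.Icc n L).sup (fun j => S.E f j q)

noncomputable def w (f : X → ℝ≥0) (p : ℝ) (L n : ℕ) (q : X) : ℝ≥0 :=
  S.M f L n q ^ (p - 1) - S.M f L (n + 1) q ^ (p - 1)

lemma E_congr (f : X → ℝ≥0) {n m : ℕ} (hnm : n ≤ m) {q q' : X} (h : q' ∈ S.D n q) :
    S.E f m q' = S.E f m q := by
  unfold E; rw [S.eq_of_le hnm h]

lemma E_sub (f : X → ℝ≥0) (n : ℕ) (q : X) :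
    S.E (fun x => f x - S.E f n x) n q = S.E (fun x => f x - S.E f n q) n q := by
  have : ∑ x ∈ S.D n q, (f x - S.E f n x) = ∑ x ∈ S.D n q, (f x - S.E f n q) :=
    Finset.sum_congr rfl fun x hx => by rw [S.E_congr f le_rfl hx]
  rw [E, this]; rfl

lemma M_congr (f : X → ℝ≥0) (L : ℕ) {n m : ℕ} (hnm : n ≤ m) {q q' : X} (h : q' ∈ S.D n q) :
    S.M f L m q' = S.M f L m q := by
  unfold M
  apply Finset.sup_congr rfl
  intro j hj
  exact S.E_congr f (hnm.trans (Finset.mem_Icc.1 hj).1) h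

lemma w_congr (f : X → ℝ≥0) (p : ℝ) (L : ℕ) {n : ℕ} {q q' : X} (h : q' ∈ S.D n q) :
    S.w f p L n q' = S.w f p L n q := by
  unfold w
  rw [S.M_congr f L le_rfl h, S.M_congr f L (Nat.le_succ n) h]

lemma M_succ (f : X → ℝ≥0) (L n : ℕ) (q : X) (h : n ≤ L) :
    S.M f L n q = max (S.E f n q) (S.M f L (n+1) q) := by
  unfold M
  rw [← Finset.insert_Icc_add_one_left_eq_Icc h, Finset.sup_insert]

lemma M_gt (f : X → ℝ≥0) (L n : ℕ) (q : X) (h : L < n) : S.M f L n q = 0 := by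
  unfold M; rw [Finset.Icc_eq_empty (by omega)]; simp

lemma M_anti (f : X → ℝ≥0) (L : ℕ) {n m : ℕ} (q : X) (h : n ≤ m) : S.M f L m q ≤ S.M f L n q := by
  unfold M; exact Finset.sup_mono (Finset.Icc_subset_Icc_left h)

lemma E_le_M (f : X → ℝ≥0) (L : ℕ) {n : ℕ} (q : X) (h : n ≤ L) : S.E f n q ≤ S.M f L n q := by
  rw [S.M_succ f L n q h]; exact le_max_left _ _

lemma E_zero (f : X → ℝ≥0) (q : X) : S.E f 0 q = f q := by
  have h1 := S.card_eq 0 q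
  rw [pow_zero, Finset.card_eq_one] at h1
  obtain ⟨a, ha⟩ := h1
  have := S.self_mem 0 q
  rw [ha, Finset.mem_singleton] at this
  subst this
  simp [E, ha]

lemma E_double (hB : 0 < B) (f : X → ℝ≥0) (n : ℕ) (q : X) : S.E f n q ≤ B * S.E f (n+1) q := by
  unfold E
  have hB' : (B : ℝ≥0) ≠ 0 := by positivity
  have : (B : ℝ≥0) * (((B : ℝ≥0) ^ (n+1))⁻¹ * ∑ x ∈ S.D (n+1) q, f x)
      = ((B : ℝ≥0) ^ n)⁻¹ * ∑ x ∈ S.D (n+1) q, f x := by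
    rw [pow_succ]; field_simp
  rw [this]
  gcongr
  exact S.mono n q

lemma sum_w (f : X → ℝ≥0) (p : ℝ) (hp : 1 < p) (L K : ℕ) (q : X) (hK : K ≤ L + 1) :
    ∑ n ∈ Finset.Ico K (L+1), S.w f p L n q = S.M f L K q ^ (p - 1) := by
  induction hK using Nat.decreasingInduction with
  | self => simp [S.M_gt f L (L+1) q (by omega), NNReal.zero_rpow (by linarith : p - 1 ≠ 0)]
  | of_succ k hk ih =>
    rw [Finset.sum_eq_sum_Ico_succ_bot (by omega), ih]
    unfold w
    apply tsub_add_cancel_of_le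
    exact NNReal.rpow_le_rpow (S.M_anti f L q (Nat.le_succ k)) (by linarith)

/-- swap lemma -/
lemma tsum_swap (hB : 0 < B) (n : ℕ) (v g : X → ℝ≥0∞) (hv : ∀ q q', q' ∈ S.D n q → v q' = v q) :
    ∑' q, v q * ((B : ℝ≥0∞) ^ n)⁻¹ * ∑ x ∈ S.D n q, g x = ∑' q, v q * g q := by
  have h1 : ∀ q, v q * ((B : ℝ≥0∞) ^ n)⁻¹ * ∑ x ∈ S.D n q, g x
      = ∑' x, if x ∈ S.D n q then v q * ((B : ℝ≥0∞) ^ n)⁻¹ * g x else 0 := by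
    intro q
    rw [Finset.mul_sum, tsum_eq_sum (s := S.D n q)]
    · exact Finset.sum_congr rfl fun x hx => by rw [if_pos hx]
    · intro x hx; rw [if_neg hx]
  simp_rw [h1]
  rw [ENNReal.tsum_comm]
  congr 1; ext x
  rw [tsum_eq_sum (s := S.D n x)]
  · have : ∀ q ∈ S.D n x, (if x ∈ S.D n q then v q * ((B : ℝ≥0∞) ^ n)⁻¹ * g x else 0)
        = v x * ((B : ℝ≥0∞) ^ n)⁻¹ * g x := by
      intro q hq
      rw [if_pos (S.mem_symm.1 hq), hv x q hq]
    rw [Finset.sum_congr rfl this, Finset.sum_const, S.card_eq, nsmul_eq_mul]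
    push_cast
    have h0 : ((B : ℝ≥0∞) ^ n) ≠ 0 := pow_ne_zero _ (by exact_mod_cast hB.ne')
    have ht : ((B : ℝ≥0∞) ^ n) ≠ ⊤ := ENNReal.pow_ne_top (by simp)
    calc (B : ℝ≥0∞) ^ n * (v x * ((B : ℝ≥0∞) ^ n)⁻¹ * g x)
        = ((B : ℝ≥0∞) ^ n * ((B : ℝ≥0∞) ^ n)⁻¹) * (v x * g x) := by ring
      _ = v x * g x := by rw [ENNReal.mul_inv_cancel h0 ht, one_mul]
  · intro q hq
    rw [if_neg]; intro h; exact hq (S.mem_symm.1 h)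

lemma tsum_swapE (hB : 0 < B) (n : ℕ) (v g : X → ℝ≥0) (hv : ∀ q q', q' ∈ S.D n q → v q' = v q) :
    ∑' q, ((v q * S.E g n q : ℝ≥0) : ℝ≥0∞) = ∑' q, ((v q * g q : ℝ≥0) : ℝ≥0∞) := by
  have := S.tsum_swap hB n (fun q => (v q : ℝ≥0∞)) (fun q => (g q : ℝ≥0∞))
    (fun q q' h => by rw [hv q q' h])
  simp only [ENNReal.coe_mul]
  rw [← this]
  congr 1; ext q
  unfold E
  have h0 : ((B : ℝ≥0) ^ n) ≠ 0 := pow_ne_zero _ (by exact_mod_cast hB.ne')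
  push_cast [ENNReal.coe_inv h0]
  ring

lemma young (p : ℝ) (hp : 1 < p) (ε a b : ℝ≥0) (hε : 0 < ε) :
    a * b ^ (p-1) ≤ (ε⁻¹) ^ (p-1) * a ^ p + ε * b ^ p := by
  have key : ∀ x : ℝ≥0, x ^ p = x * x ^ (p-1) := by
    intro x
    rcases eq_or_ne x 0 with rfl | hx
    · rw [NNReal.zero_rpow (by linarith)]; simp
    · have := NNReal.rpow_add hx 1 (p-1)
      rw [NNReal.rpow_one] at this; rw [← this]; congr 1; ring
  rcases le_total a (ε * b) with h | h
  · calc a * b ^ (p-1) ≤ ε * b * b ^ (p-1) := by gcongr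
      _ = ε * b ^ p := by rw [key b]; ring
      _ ≤ _ := le_add_self
  · have hb : b ≤ ε⁻¹ * a := by
      calc b = ε⁻¹ * (ε * b) := by field_simp
        _ ≤ _ := by gcongr
    calc a * b ^ (p-1) ≤ a * (ε⁻¹ * a) ^ (p-1) := by
          gcongr
      _ = (ε⁻¹) ^ (p-1) * a ^ p := by rw [NNReal.mul_rpow, key a]; ring
      _ ≤ _ := le_self_add

lemma doob_alg (p : ℝ) (hp : 1 < p) (a b : ℝ≥0) (hab : b ≤ a) :
    a ^ p ≤ (p/(p-1)).toNNReal * (a * (a ^ (p-1) - b ^ (p-1))) + b ^ p := by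
  have hle : b ^ (p-1) ≤ a ^ (p-1) := NNReal.rpow_le_rpow hab (by linarith)
  have hp1 : 0 < p - 1 := by linarith
  rw [← NNReal.coe_le_coe]
  push_cast [NNReal.coe_sub hle]
  rw [Real.coe_toNNReal _ (by positivity)]
  have ha : (0:ℝ) ≤ a := a.2
  have hb : (0:ℝ) ≤ b := b.2
  clear hle hab
  generalize (a : ℝ) = a at *
  generalize (b : ℝ) = b at *
  have hy := Real.geom_mean_le_arith_mean2_weighted (w₁ := 1/p) (w₂ := (p-1)/p) (p₁ := a^p) (p₂ := b^p)
    (by positivity) (by positivity) (by positivity) (by positivity) (by field_simp; ring)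
  rw [← Real.rpow_mul ha, ← Real.rpow_mul hb, mul_one_div_cancel (by linarith), Real.rpow_one,
    mul_div_cancel₀ _ (by linarith)] at hy
  have hk : a * a ^ (p-1) = a ^ p := by
    rcases eq_or_ne a 0 with rfl | hx
    · rw [Real.zero_rpow (by linarith : p ≠ 0), zero_mul]
    · have := Real.rpow_add (lt_of_le_of_ne ha hx.symm) 1 (p-1)
      rw [Real.rpow_one] at this; rw [← this]; congr 1; ring
  have h2 : p * (a * b ^ (p-1)) ≤ a ^ p + (p-1) * b ^ p := by
    calc p * (a * b ^ (p-1)) ≤ p * (1/p * a ^ p + (p-1)/p * b ^ p) := by gcongr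
      _ = _ := by field_simp
  rw [mul_sub, hk]
  have : p / (p-1) * (a^p - a * b ^ (p-1)) = (p * a ^ p - p * (a * b ^ (p-1))) / (p-1) := by
    field_simp
  rw [this, ← sub_le_iff_le_add, le_div_iff₀ hp1]
  nlinarith

lemma doob_path (f : X → ℝ≥0) (p : ℝ) (hp : 1 < p) (L K : ℕ) (q : X) (hK : K ≤ L + 1) :
    S.M f L K q ^ p ≤
      (p/(p-1)).toNNReal * ∑ n ∈ Finset.Ico K (L+1), S.w f p L n q * S.E f n q := by
  induction hK using Nat.decreasingInduction with
  | self => simp [S.M_gt f L (L+1) q (by omega), NNReal.zero_rpow (by linarith : p ≠ 0)]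
  | of_succ k hk ih =>
    rw [Finset.sum_eq_sum_Ico_succ_bot (by omega), mul_add]
    refine (doob_alg p hp _ _ (S.M_anti f L q (Nat.le_succ k))).trans ?_
    refine add_le_add ?_ ih
    refine mul_le_mul_right ?_ _
    rw [mul_comm]
    change S.w f p L k q * _ ≤ _
    have h1 := S.M_succ f L k q (by omega)
    rcases le_total (S.E f k q) (S.M f L (k+1) q) with h | h
    · rw [max_eq_right h] at h1
      unfold w; rw [h1]; simp
    · rw [max_eq_left h] at h1
      rw [h1]

lemma jensen (hB : 0 < B) (f : X → ℝ≥0) (p : ℝ) (hp : 1 < p) (n : ℕ) (q : X) :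
    S.E f n q ^ p ≤ S.E (fun x => f x ^ p) n q := by
  unfold E
  have h0 : ((B : ℝ≥0) ^ n) ≠ 0 := pow_ne_zero _ (by exact_mod_cast hB.ne')
  rw [Finset.mul_sum, Finset.mul_sum]
  apply NNReal.rpow_arith_mean_le_arith_mean_rpow _ _ _ _ hp.le
  rw [Finset.sum_const, S.card_eq, nsmul_eq_mul]
  push_cast
  exact mul_inv_cancel₀ h0

lemma M_finite (hB : 0 < B) (f : X → ℝ≥0) (p : ℝ) (hp : 1 < p) (L : ℕ)
    (hf : ∑' q, ((f q ^ p : ℝ≥0) : ℝ≥0∞) ≠ ⊤) :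
    ∑' q, ((S.M f L 0 q ^ p : ℝ≥0) : ℝ≥0∞) ≠ ⊤ := by
  have h1 : ∀ q, S.M f L 0 q ^ p ≤ ∑ n ∈ Finset.range (L+1), S.E (fun x => f x ^ p) n q := by
    intro q
    obtain ⟨j, hj, hj'⟩ := Finset.exists_mem_eq_sup (Finset.Icc 0 L) ⟨0, by simp⟩
      (fun j => S.E f j q)
    unfold M
    rw [hj']
    refine (S.jensen hB f p hp j q).trans ?_
    exact Finset.single_le_sum (f := fun n => S.E (fun x => f x ^ p) n q) (fun _ _ => zero_le)
      (by simp at hj ⊢; omega)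
  refine ne_top_of_le_ne_top ?_ (ENNReal.tsum_le_tsum fun q => ENNReal.coe_le_coe.2 (h1 q))
  push_cast
  rw [Summable.tsum_finsetSum (fun _ _ => ENNReal.summable)]
  rw [ENNReal.sum_ne_top]
  intro n _
  have := S.tsum_swapE hB n (fun _ => 1) (fun x => f x ^ p) (fun _ _ _ => rfl)
  simp only [one_mul] at this
  rw [this]; exact hf


lemma absorb {x a : ℝ≥0∞} (hx : x ≠ ⊤) (h : x ≤ a + 2⁻¹ * x) : x ≤ 2 * a := by
  rcases eq_or_ne a ⊤ with rfl | ha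
  · simp
  lift x to ℝ≥0 using hx
  lift a to ℝ≥0 using ha
  have e : (2⁻¹ : ℝ≥0∞) = ((2⁻¹ : ℝ≥0) : ℝ≥0∞) := by
    rw [ENNReal.coe_inv (by norm_num)]; norm_num
  rw [e] at h
  have h' : x ≤ a + 2⁻¹ * x := by exact_mod_cast h
  have h2 : x ≤ 2 * a := by
    rw [← NNReal.coe_le_coe] at h' ⊢
    push_cast at h' ⊢
    linarith
  exact_mod_cast h2

omit [DecidableEq X] in
lemma tsum_young (p : ℝ) (hp : 1 < p) (ε : ℝ≥0) (hε : 0 < ε) (a b : X → ℝ≥0) :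
    ∑' q, ((a q * b q ^ (p-1) : ℝ≥0) : ℝ≥0∞) ≤
      ((ε⁻¹ ^ (p-1) : ℝ≥0) : ℝ≥0∞) * ∑' q, ((a q ^ p : ℝ≥0) : ℝ≥0∞) +
      ε * ∑' q, ((b q ^ p : ℝ≥0) : ℝ≥0∞) := by
  rw [← ENNReal.tsum_mul_left, ← ENNReal.tsum_mul_left, ← ENNReal.tsum_add]
  refine ENNReal.tsum_le_tsum fun q => ?_
  exact_mod_cast young p hp ε (a q) (b q) hε

lemma tsum_w_mul (f G : X → ℝ≥0) (p : ℝ) (hp : 1 < p) (L : ℕ) :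
    ∑ n ∈ Finset.Ico 0 (L+1), ∑' q, ((S.w f p L n q * G q : ℝ≥0) : ℝ≥0∞) =
    ∑' q, ((G q * S.M f L 0 q ^ (p-1) : ℝ≥0) : ℝ≥0∞) := by
  rw [← Summable.tsum_finsetSum (fun _ _ => ENNReal.summable)]
  congr 1; ext q
  rw [← S.sum_w f p hp L 0 q (by omega), Finset.mul_sum]
  push_cast
  exact Finset.sum_congr rfl fun _ _ => mul_comm _ _

lemma doob (hB : 0 < B) (p : ℝ) (hp : 1 < p) : ∃ c : ℝ≥0, 0 < c ∧ ∀ (f : X → ℝ≥0) (L : ℕ),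
    ∑' q, ((f q ^ p : ℝ≥0) : ℝ≥0∞) ≠ ⊤ →
    ∑' q, ((S.M f L 0 q ^ p : ℝ≥0) : ℝ≥0∞) ≤ c * ∑' q, ((f q ^ p : ℝ≥0) : ℝ≥0∞) := by
  set c1 : ℝ≥0 := (p/(p-1)).toNNReal with hc1
  have hc1p : 0 < c1 := Real.toNNReal_pos.2 (div_pos (by linarith) (by linarith))
  set ε : ℝ≥0 := (2 * c1)⁻¹ with hε
  have hεp : 0 < ε := by positivity
  refine ⟨2 * (c1 * ε⁻¹ ^ (p-1)), by positivity, fun f L hf => ?_⟩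
  have h1 : ∑' q, ((S.M f L 0 q ^ p : ℝ≥0) : ℝ≥0∞) ≤
      c1 * ∑' q, ((f q * S.M f L 0 q ^ (p-1) : ℝ≥0) : ℝ≥0∞) := by
    rw [← S.tsum_w_mul f f p hp L]
    have : ∀ n, ∑' q, ((S.w f p L n q * f q : ℝ≥0) : ℝ≥0∞)
        = ∑' q, ((S.w f p L n q * S.E f n q : ℝ≥0) : ℝ≥0∞) := fun n =>
      (S.tsum_swapE hB n (S.w f p L n) f (fun q q' h => S.w_congr f p L h)).symm
    simp_rw [this]
    rw [← Summable.tsum_finsetSum (fun _ _ => ENNReal.summable), ← ENNReal.tsum_mul_left]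
    refine ENNReal.tsum_le_tsum fun q => ?_
    exact_mod_cast S.doob_path f p hp L 0 q (by omega)
  have h2 := tsum_young p hp ε hεp f (S.M f L 0)
  have h3 := absorb (S.M_finite hB f p hp L hf)
    (a := ((c1 * ε⁻¹ ^ (p-1) : ℝ≥0) : ℝ≥0∞) * ∑' q, ((f q ^ p : ℝ≥0) : ℝ≥0∞)) (by
      refine h1.trans ((mul_le_mul_right h2 _).trans (le_of_eq ?_))
      have e : (2⁻¹ : ℝ≥0∞) = ((c1 * ε : ℝ≥0) : ℝ≥0∞) := by
        have : c1 * ε = 2⁻¹ := by rw [hε]; field_simp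
        rw [this, ENNReal.coe_inv (by norm_num)]; norm_num
      rw [e]
      push_cast
      ring)
  refine h3.trans (le_of_eq ?_)
  push_cast
  ring

lemma lower (hB : 0 < B) (f : X → ℝ≥0) (p : ℝ) (hp : 1 < p) (L : ℕ) (q : X)
    (h0 : f q ≠ 0) (hL : S.E f L q ≤ f q / 2) :
    f q ^ p ≤ 2 * (2 * B) ^ (p-1) *
      ∑ n ∈ Finset.Ico 0 (L+1), S.w f p L n q * (f q - S.E f n q) := by
  have hpos : 0 < f q := pos_iff_ne_zero.2 h0
  have hhalf : f q / 2 < f q := NNReal.half_lt_self h0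
  have hex : ∃ n, S.M f L n q ≤ f q / 2 := ⟨L + 1, by rw [S.M_gt f L _ q (by omega)]; exact zero_le⟩
  classical
  obtain ⟨K, hK, hmin⟩ : ∃ K, S.M f L K q ≤ f q / 2 ∧ ∀ m < K, ¬ S.M f L m q ≤ f q / 2 :=
    ⟨Nat.find hex, Nat.find_spec hex, fun m hm => Nat.find_min hex hm⟩
  have hML : S.M f L L q ≤ f q / 2 := by
    rw [S.M_succ f L L q le_rfl, S.M_gt f L (L+1) q (by omega)]
    simpa using hL
  have hKL : K ≤ L := by
    by_contra h; exact hmin L (by omega) hML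
  obtain ⟨k, rfl⟩ : ∃ k, K = k + 1 := by
    refine ⟨K - 1, ?_⟩
    rcases Nat.eq_zero_or_pos K with rfl | h
    · exfalso
      have := S.E_le_M f L q (Nat.zero_le L)
      rw [S.E_zero] at this
      exact absurd (this.trans hK) (not_le.2 hhalf)
    · omega
  have hEk : f q / 2 < S.E f k q := by
    have h1 := hmin k (by omega)
    rw [S.M_succ f L k q (by omega), max_le_iff] at h1
    by_contra h
    exact h1 ⟨not_lt.1 h, hK⟩
  have hMK : f q ≤ 2 * B * S.M f L (k+1) q := by
    have h1 := hEk.le.trans ((S.E_double hB f k q).trans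
      (mul_le_mul_right (S.E_le_M f L q hKL) _))
    rw [div_le_iff₀ (by norm_num)] at h1
    calc f q ≤ _ := h1
      _ = _ := by ring
  have hsum : f q / 2 * S.M f L (k+1) q ^ (p-1) ≤
      ∑ n ∈ Finset.Ico 0 (L+1), S.w f p L n q * (f q - S.E f n q) := by
    rw [← S.sum_w f p hp L (k+1) q (by omega), Finset.mul_sum]
    refine le_trans ?_ (Finset.sum_le_sum_of_subset
      (Finset.Ico_subset_Ico_left (Nat.zero_le (k+1))))
    refine Finset.sum_le_sum fun n hn => ?_
    rw [Finset.mem_Ico] at hn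
    rw [mul_comm]
    gcongr
    apply le_tsub_of_add_le_right
    have : S.E f n q ≤ f q / 2 := (S.E_le_M f L q (by omega)).trans
      ((S.M_anti f L q hn.1).trans hK)
    calc f q / 2 + S.E f n q ≤ f q / 2 + f q / 2 := by gcongr
      _ = f q := add_halves _
  calc f q ^ p = f q * f q ^ (p-1) := by
        have := NNReal.rpow_add h0 1 (p-1)
        rw [NNReal.rpow_one] at this; rw [← this]; congr 1; ring
    _ ≤ f q * (2 * B * S.M f L (k+1) q) ^ (p-1) := by gcongr
    _ = 2 * (2 * B) ^ (p-1) * (f q / 2 * S.M f L (k+1) q ^ (p-1)) := by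
        rw [NNReal.mul_rpow]; field_simp
    _ ≤ _ := by gcongr

lemma E_small (hB : 1 < B) (f : X → ℝ≥0) (p : ℝ) (hp : 1 < p)
    (hf : ∑' q, ((f q ^ p : ℝ≥0) : ℝ≥0∞) ≠ ⊤) (q : X) (δ : ℝ≥0) (hδ : 0 < δ) :
    ∀ᶠ n in Filter.atTop, S.E f n q ≤ δ := by
  obtain ⟨T, hT⟩ := WithTop.ne_top_iff_exists.1 hf
  change (T : ℝ≥0∞) = _ at hT
  have hB' : (1 : ℝ≥0) < B := by exact_mod_cast hB
  have h1 : Filter.Tendsto (fun n : ℕ => ((B : ℝ≥0)⁻¹) ^ n * T) Filter.atTop (nhds (0 * T)) :=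
    (NNReal.tendsto_pow_atTop_nhds_zero_of_lt_one (inv_lt_one_of_one_lt₀ hB')).mul_const T
  rw [zero_mul] at h1
  have h2 := h1.eventually (gt_mem_nhds (NNReal.rpow_pos (p := p) hδ))
  filter_upwards [h2] with n hn
  have h3 : S.E f n q ^ p ≤ δ ^ p := by
    refine (S.jensen (by omega) f p hp n q).trans (le_trans ?_ hn.le)
    unfold E
    rw [inv_pow]
    gcongr
    have : ((∑ x ∈ S.D n q, f x ^ p : ℝ≥0) : ℝ≥0∞) ≤ T := by
      rw [hT]; push_cast
      exact ENNReal.sum_le_tsum _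
    exact_mod_cast this
  exact (NNReal.rpow_le_rpow_iff (by linarith)).1 h3

theorem main (hB : 1 < B) (p : ℝ) (hp : 1 < p) : ∃ N : ℝ≥0, 0 < N ∧ ∀ (f G : X → ℝ≥0),
    (∀ n q, S.E (fun x => f x - S.E f n x) n q ≤ G q) →
    ∑' q, ((f q ^ p : ℝ≥0) : ℝ≥0∞) ≠ ⊤ →
    ∑' q, ((f q ^ p : ℝ≥0) : ℝ≥0∞) ≤ N * ∑' q, ((G q ^ p : ℝ≥0) : ℝ≥0∞) := by
  have hB0 : 0 < B := by omega
  obtain ⟨c2, hc2, hdoob⟩ := S.doob hB0 p hp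
  set c3 : ℝ≥0 := 2 * (2 * B) ^ (p-1) with hc3
  have hBp : (0 : ℝ≥0) < B := by exact_mod_cast hB0
  have hc3p : 0 < c3 := mul_pos (by norm_num) (NNReal.rpow_pos (by positivity))
  set ε : ℝ≥0 := (2 * c3 * c2)⁻¹ with hε
  have hεp : 0 < ε := by positivity
  refine ⟨2 * (c3 * ε⁻¹ ^ (p-1)), by positivity, fun f G hG hf => ?_⟩
  have hF : ∀ F : Finset X, ∑ q ∈ F, ((f q ^ p : ℝ≥0) : ℝ≥0∞) ≤
      ((c3 * ε⁻¹ ^ (p-1) : ℝ≥0) : ℝ≥0∞) * ∑' q, ((G q ^ p : ℝ≥0) : ℝ≥0∞) +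
      2⁻¹ * ∑' q, ((f q ^ p : ℝ≥0) : ℝ≥0∞) := by
    intro F
    have hev : ∀ᶠ n in Filter.atTop, ∀ q ∈ F, f q ≠ 0 → S.E f n q ≤ f q / 2 := by
      rw [Filter.eventually_all_finset]
      intro q _
      by_cases h : f q = 0
      · simp [h]
      · filter_upwards [S.E_small hB f p hp hf q (f q / 2)
          (div_pos (pos_iff_ne_zero.2 h) (by norm_num))] with n hn _ using hn
    obtain ⟨L, hL⟩ := hev.exists
    have h1 : ∑ q ∈ F, ((f q ^ p : ℝ≥0) : ℝ≥0∞) ≤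
        c3 * ∑' q, ((G q * S.M f L 0 q ^ (p-1) : ℝ≥0) : ℝ≥0∞) := by
      calc ∑ q ∈ F, ((f q ^ p : ℝ≥0) : ℝ≥0∞)
          ≤ ∑ q ∈ F, ((c3 * ∑ n ∈ Finset.Ico 0 (L+1), S.w f p L n q * (f q - S.E f n q) : ℝ≥0) : ℝ≥0∞) := by
            refine Finset.sum_le_sum fun q hq => ENNReal.coe_le_coe.2 ?_
            by_cases h : f q = 0
            · rw [h, NNReal.zero_rpow (by linarith)]; exact zero_le
            · exact S.lower hB0 f p hp L q h (hL q hq h)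
        _ ≤ ∑' q, ((c3 * ∑ n ∈ Finset.Ico 0 (L+1), S.w f p L n q * (f q - S.E f n q) : ℝ≥0) : ℝ≥0∞) :=
            ENNReal.sum_le_tsum _
        _ = c3 * ∑ n ∈ Finset.Ico 0 (L+1), ∑' q, ((S.w f p L n q * (f q - S.E f n q) : ℝ≥0) : ℝ≥0∞) := by
            rw [← Summable.tsum_finsetSum (fun _ _ => ENNReal.summable), ← ENNReal.tsum_mul_left]
            congr 1; ext q; rw [ENNReal.coe_mul, ENNReal.ofNNReal_finsetSum]
        _ = c3 * ∑ n ∈ Finset.Ico 0 (L+1), ∑' q,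
              ((S.w f p L n q * S.E (fun x => f x - S.E f n x) n q : ℝ≥0) : ℝ≥0∞) := by
            congr 1
            refine Finset.sum_congr rfl fun n _ => ?_
            exact (S.tsum_swapE hB0 n (S.w f p L n) (fun x => f x - S.E f n x)
              (fun q q' h => S.w_congr f p L h)).symm
        _ ≤ c3 * ∑ n ∈ Finset.Ico 0 (L+1), ∑' q, ((S.w f p L n q * G q : ℝ≥0) : ℝ≥0∞) := by
            refine mul_le_mul_right (Finset.sum_le_sum fun n _ => ENNReal.tsum_le_tsum fun q =>
              ENNReal.coe_le_coe.2 (mul_le_mul_right (hG n q) _)) _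
        _ = _ := by rw [S.tsum_w_mul f G p hp L]
    refine h1.trans ((mul_le_mul_right (tsum_young p hp ε hεp G (S.M f L 0)) _).trans ?_)
    rw [mul_add]
    refine add_le_add (le_of_eq ?_) ?_
    · push_cast; ring
    · refine (mul_le_mul_right (mul_le_mul_right (hdoob f L hf) _) _).trans (le_of_eq ?_)
      have e : (2⁻¹ : ℝ≥0∞) = ((c3 * ε * c2 : ℝ≥0) : ℝ≥0∞) := by
        have : c3 * ε * c2 = 2⁻¹ := by rw [hε]; field_simp
        rw [this, ENNReal.coe_inv (by norm_num)]; norm_num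
      rw [e]; push_cast; ring
  have := absorb hf (ENNReal.summable.tsum_le_of_sum_le hF)
  refine this.trans (le_of_eq ?_)
  push_cast; ring

end Dya

lemma div_aux (m a b : ℤ) (hm : 0 < m) :
    (m * (a / m) ≤ b ∧ b ≤ m * (a / m) + m - 1) ↔ b / m = a / m := by
  have h1 := Int.mul_ediv_add_emod b m
  have h2 := Int.emod_nonneg b hm.ne'
  have h3 := Int.emod_lt_of_pos b hm
  constructor
  · rintro ⟨h4, h5⟩
    rw [Int.ediv_eq_iff_of_pos hm]
    constructor <;> nlinarith
  · intro h
    rw [← h]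
    constructor <;> linarith

def Dc (d n : ℕ) (q : ℤ × (Fin d → ℤ)) : Finset (ℤ × (Fin d → ℤ)) :=
  Finset.Icc ((4:ℤ)^n * (q.1 / (4:ℤ)^n)) ((4:ℤ)^n * (q.1 / (4:ℤ)^n) + (4:ℤ)^n - 1) ×ˢ
    Finset.Icc (fun i => (2:ℤ)^n * (q.2 i / (2:ℤ)^n))
      (fun i => (2:ℤ)^n * (q.2 i / (2:ℤ)^n) + (2:ℤ)^n - 1)

lemma mem_Dc (d n : ℕ) (q q' : ℤ × (Fin d → ℤ)) :
    q' ∈ Dc d n q ↔ q'.1 / (4:ℤ)^n = q.1 / (4:ℤ)^n ∧ ∀ i, q'.2 i / (2:ℤ)^n = q.2 i / (2:ℤ)^n := by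
  unfold Dc
  rw [Finset.mem_product, Finset.mem_Icc, Finset.mem_Icc, div_aux _ _ _ (by positivity),
    Pi.le_def, Pi.le_def, ← forall_and]
  simp_rw [div_aux _ _ _ (by positivity : (0:ℤ) < 2 ^ n)]

def dyaC (d : ℕ) : Dya (ℤ × (Fin d → ℤ)) (4 * 2 ^ d) where
  D := Dc d
  self_mem n q := by rw [mem_Dc]; simp
  eq_of_mem n q q' h := by
    rw [mem_Dc] at h
    unfold Dc
    rw [h.1]; simp_rw [h.2]
  card_eq n q := by
    unfold Dc
    rw [Finset.card_product, Pi.card_Icc, Int.card_Icc]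
    simp only [Int.card_Icc]
    have e1 : ∀ a b : ℤ, a + b - 1 + 1 - a = b := fun a b => by ring
    simp_rw [e1]
    rw [Finset.prod_const, Finset.card_univ, Fintype.card_fin]
    have : ((4:ℤ)^n).toNat = 4 ^ n := by
      have : ((4:ℤ)^n) = ((4^n : ℕ) : ℤ) := by push_cast; rfl
      rw [this, Int.toNat_natCast]
    rw [this]
    have : ((2:ℤ)^n).toNat = 2 ^ n := by
      have : ((2:ℤ)^n) = ((2^n : ℕ) : ℤ) := by push_cast; rfl
      rw [this, Int.toNat_natCast]
    rw [this, mul_pow, ← pow_mul, ← pow_mul, mul_comm n d]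
  mono n q q' h := by
    rw [mem_Dc] at h ⊢
    simp_rw [pow_succ, ← Int.ediv_ediv_of_nonneg (by positivity : (0:ℤ) ≤ 4 ^ n),
      ← Int.ediv_ediv_of_nonneg (by positivity : (0:ℤ) ≤ 2 ^ n)]
    rw [h.1]; simp_rw [h.2]; simp

lemma Dc_sub (d n : ℕ) (q : ℤ × (Fin d → ℤ)) : Dc d n q ⊆ Qbox d (2^n) q := by
  intro q' h
  have h1 := h
  rw [mem_Dc] at h
  have key : ∀ m a b : ℤ, 0 < m → b / m = a / m → a - m + 1 ≤ b ∧ b ≤ a + m - 1 := by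
    intro m a b hm hab
    have h1 := Int.mul_ediv_add_emod b m
    have h2 := Int.emod_nonneg b hm.ne'
    have h3 := Int.emod_lt_of_pos b hm
    have h1' := Int.mul_ediv_add_emod a m
    have h2' := Int.emod_nonneg a hm.ne'
    have h3' := Int.emod_lt_of_pos a hm
    rw [hab] at h1
    constructor <;> linarith
  have e4 : (((2^n : ℕ) : ℤ))^2 = 4 ^ n := by
    push_cast; rw [← pow_mul, mul_comm, pow_mul]; norm_num
  unfold Qbox
  rw [Finset.mem_product, Finset.mem_Icc, Finset.mem_Icc, e4, Pi.le_def, Pi.le_def, ← forall_and]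
  refine ⟨key _ _ _ (by positivity) h.1, fun i => ?_⟩
  push_cast
  exact key _ _ _ (by positivity) (h.2 i)

lemma Qbox_card (d n : ℕ) (q : ℤ × (Fin d → ℤ)) :
    (Qbox d (2^n) q).card ≤ 2 ^ (d+1) * (4 * 2 ^ d) ^ n := by
  unfold Qbox
  rw [Finset.card_product, Pi.card_Icc, Int.card_Icc]
  simp only [Int.card_Icc]
  have e4 : (((2^n : ℕ) : ℤ))^2 = ((4 ^ n : ℕ) : ℤ) := by
    push_cast; rw [← pow_mul, mul_comm, pow_mul]; norm_num
  rw [e4]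
  have b1 : ∀ (a : ℤ) (m : ℕ), (a + m - 1 + 1 - (a - m + 1)).toNat ≤ 2 * m := by
    intro a m; omega
  calc _ ≤ (2 * 4 ^ n) * ∏ i : Fin d, (2 * 2 ^ n) :=
        Nat.mul_le_mul (b1 _ _) (Finset.prod_le_prod' fun i _ => b1 _ _)
    _ = _ := by
      rw [Finset.prod_const, Finset.card_univ, Fintype.card_fin, mul_pow, mul_pow, ← pow_mul,
        ← pow_mul, mul_comm n d]
      ring

lemma self_mem_Qbox (d : ℕ) (r : ℕ+) (q : ℤ × (Fin d → ℤ)) : q ∈ Qbox d r q := by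
  have hr : (1:ℤ) ≤ (r : ℕ) := by exact_mod_cast r.2
  unfold Qbox
  rw [Finset.mem_product, Finset.mem_Icc, Finset.mem_Icc, Pi.le_def, Pi.le_def, ← forall_and]
  refine ⟨⟨by nlinarith, by nlinarith⟩, fun i => ⟨by linarith, by linarith⟩⟩

lemma avgAbs_nonneg {d : ℕ} (h : ℤ → (Fin d → ℤ) → ℝ) (A : Finset (ℤ × (Fin d → ℤ))) :
    0 ≤ avgAbs h A := by unfold avgAbs; positivity

lemma sharp_bdd {d : ℕ} (h : ℤ → (Fin d → ℤ) → ℝ) (H : ℝ) (hH : ∀ q : ℤ × (Fin d → ℤ), |h q.1 q.2| ≤ H)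
    (q : ℤ × (Fin d → ℤ)) :
    BddAbove (Set.range fun r : ℕ+ => ((Qbox d (r : ℕ) q).card : ℝ)⁻¹ *
    ∑ p ∈ Qbox d (r : ℕ) q, |h p.1 p.2 - avgAbs h (Qbox d (r : ℕ) q)|) := by
  refine ⟨2 * H, ?_⟩
  rintro _ ⟨r, rfl⟩
  have hc : (0:ℝ) < (Qbox d (r : ℕ) q).card := by
    exact_mod_cast Finset.card_pos.2 ⟨q, self_mem_Qbox d r q⟩
  have ha : avgAbs h (Qbox d r q) ≤ H := by
    unfold avgAbs
    rw [inv_mul_le_iff₀ hc]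
    calc _ ≤ ∑ _p ∈ Qbox d (r : ℕ) q, H := Finset.sum_le_sum fun p _ => hH p
      _ = _ := by rw [Finset.sum_const, nsmul_eq_mul]
  have ha0 := avgAbs_nonneg h (Qbox d r q)
  simp only
  rw [inv_mul_le_iff₀ hc]
  calc _ ≤ ∑ _p ∈ Qbox d (r : ℕ) q, 2 * H := by
        refine Finset.sum_le_sum fun p _ => ?_
        have := abs_sub (h p.1 p.2) (avgAbs h (Qbox d r q))
        rw [abs_of_nonneg ha0] at this
        linarith [hH p]
    _ = _ := by rw [Finset.sum_const, nsmul_eq_mul]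

lemma sharp_nonneg {d : ℕ} (h : ℤ → (Fin d → ℤ) → ℝ) (q : ℤ × (Fin d → ℤ)) : 0 ≤ sharp h q :=
  Real.iSup_nonneg fun r => by positivity

lemma osc_le {d : ℕ} (h : ℤ → (Fin d → ℤ) → ℝ) (H : ℝ) (hH : ∀ q : ℤ × (Fin d → ℤ), |h q.1 q.2| ≤ H)
    (n : ℕ) (q : ℤ × (Fin d → ℤ)) :
    (dyaC d).E (fun x => (|h x.1 x.2|).toNNReal -
      (dyaC d).E (fun y => (|h y.1 y.2|).toNNReal) n x) n q ≤ (2 ^ (d+2) * sharp h q).toNNReal := by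
  have hs0 := sharp_nonneg h q
  set f : ℤ × (Fin d → ℤ) → ℝ≥0 := fun y => (|h y.1 y.2|).toNNReal with hf
  have hfc : ∀ y, (f y : ℝ) = |h y.1 y.2| := fun y => Real.coe_toNNReal _ (abs_nonneg _)
  set e := (dyaC d).E f n q with he
  have h1 : (dyaC d).E (fun x => f x - (dyaC d).E f n x) n q = (dyaC d).E (fun x => f x - e) n q :=
    (dyaC d).E_sub f n q
  change (dyaC d).E (fun x => f x - (dyaC d).E f n x) n q ≤ _
  rw [h1, ← NNReal.coe_le_coe, Real.coe_toNNReal _ (by positivity)]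
  set c := avgAbs h (Qbox d (2^n) q) with hc
  have hc0 : 0 ≤ c := avgAbs_nonneg h _
  set b : ℝ := ((4 * 2 ^ d : ℕ) : ℝ) ^ n with hb
  have hbp : 0 < b := by positivity
  have hcard : ((Dc d n q).card : ℝ) = b := by
    have := (dyaC d).card_eq n q
    change (Dc d n q).card = _ at this
    rw [this, hb]; push_cast; rfl
  set A : ℝ := ∑ x ∈ Dc d n q, |h x.1 x.2 - c| with hA
  -- sharp bound
  have hA1 : A ≤ 2 ^ (d+1) * b * sharp h q := by
    have hle : ((Qbox d (2^n) q).card : ℝ)⁻¹ * ∑ p ∈ Qbox d (2^n) q, |h p.1 p.2 - c| ≤ sharp h q := by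
      have := le_ciSup (sharp_bdd h H hH q) (⟨2^n, by positivity⟩ : ℕ+)
      exact this
    have hcp : (0:ℝ) < (Qbox d (2^n) q).card := by
      exact_mod_cast Finset.card_pos.2 ⟨q, self_mem_Qbox d ⟨2^n, by positivity⟩ q⟩
    rw [inv_mul_le_iff₀ hcp] at hle
    have hq : ((Qbox d (2^n) q).card : ℝ) ≤ 2 ^ (d+1) * b := by
      rw [hb]; exact_mod_cast Qbox_card d n q
    calc A ≤ ∑ p ∈ Qbox d (2^n) q, |h p.1 p.2 - c| :=
          Finset.sum_le_sum_of_subset_of_nonneg (Dc_sub d n q) fun _ _ _ => abs_nonneg _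
      _ ≤ _ := hle
      _ ≤ _ := by gcongr
  have hpt : ∀ x : ℤ × (Fin d → ℤ), |(f x : ℝ) - c| ≤ |h x.1 x.2 - c| := by
    intro x
    rw [hfc]
    have := abs_abs_sub_abs_le_abs_sub (h x.1 x.2) c
    rwa [abs_of_nonneg hc0] at this
  have hee : b * (e : ℝ) = ∑ x ∈ Dc d n q, (f x : ℝ) := by
    rw [he]; unfold Dya.E
    push_cast
    rw [hb]
    change _ * (_ * ∑ x ∈ Dc d n q, (f x : ℝ)) = _
    push_cast
    field_simp
  have hce : b * c - b * e ≤ A := by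
    rw [hee, ← hcard, ← nsmul_eq_mul, ← Finset.sum_const, ← Finset.sum_sub_distrib]
    refine Finset.sum_le_sum fun x _ => ?_
    have := hpt x
    rw [abs_sub_comm] at this
    exact (le_abs_self _).trans this
  have hterm : ∀ x : ℤ × (Fin d → ℤ), ((f x - e : ℝ≥0) : ℝ) ≤ |h x.1 x.2 - c| + max (c - e) 0 := by
    intro x
    rw [NNReal.coe_sub_def]
    have h3 := (le_abs_self _).trans (hpt x)
    have h4 := abs_nonneg (h x.1 x.2 - c)
    apply max_le
    · linarith [le_max_left (c - e) 0]
    · linarith [le_max_right (c - e) 0]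
  have hmax : b * max (c - e) 0 ≤ A := by
    rcases le_total (c - e) 0 with h5 | h5
    · rw [max_eq_right h5, mul_zero]; exact Finset.sum_nonneg fun _ _ => abs_nonneg _
    · rw [max_eq_left h5, mul_sub]; exact hce
  have hfin : ∑ x ∈ Dc d n q, ((f x - e : ℝ≥0) : ℝ) ≤ A + A := by
    calc _ ≤ ∑ x ∈ Dc d n q, (|h x.1 x.2 - c| + max (c - e) 0) :=
          Finset.sum_le_sum fun x _ => hterm x
      _ = A + b * max (c - e) 0 := by
          rw [Finset.sum_add_distrib, Finset.sum_const, nsmul_eq_mul, hcard]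
      _ ≤ _ := by linarith
  unfold Dya.E
  rw [NNReal.coe_mul, NNReal.coe_inv, NNReal.coe_sum, NNReal.coe_pow, NNReal.coe_natCast,
    ← hb, inv_mul_le_iff₀ hbp]
  change ∑ x ∈ Dc d n q, ((f x - e : ℝ≥0) : ℝ) ≤ _
  calc _ ≤ A + A := hfin
    _ ≤ 2 ^ (d+1) * b * sharp h q + 2 ^ (d+1) * b * sharp h q := by linarith
    _ = _ := by ring

/-- Theorem 12.2: discrete parabolic Fefferman–Stein inequality. -/
theorem discrete_fefferman_stein
    (d : ℕ) (hd : 1 ≤ d) (p : ℝ) (hp : 1 < p) :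
    ∃ N : ℝ, 0 < N ∧
      ∀ h : ℤ → (Fin d → ℤ) → ℝ,
        (∑' q : ℤ × (Fin d → ℤ), ENNReal.ofReal (|h q.1 q.2| ^ p)) ≠ ⊤ →
        ∑' q : ℤ × (Fin d → ℤ), ENNReal.ofReal (|h q.1 q.2| ^ p) ≤
          ENNReal.ofReal N * ∑' q : ℤ × (Fin d → ℤ), ENNReal.ofReal (sharp h q ^ p) := by
  obtain ⟨N, hN, hmain⟩ := (dyaC d).main (by
    have : 1 ≤ 2 ^ d := Nat.one_le_two_pow
    omega) p hp
  refine ⟨N * (2 ^ (d+2)) ^ p, by positivity, fun h hh => ?_⟩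
  have hp0 : 0 ≤ p := by linarith
  have e1 : ∀ x : ℝ, 0 ≤ x → ENNReal.ofReal (x ^ p) = ((x.toNNReal ^ p : ℝ≥0) : ℝ≥0∞) := by
    intro x hx
    rw [ENNReal.ofReal, Real.toNNReal_rpow_of_nonneg hx]
  have e2 : ∀ q : ℤ × (Fin d → ℤ), ENNReal.ofReal (|h q.1 q.2| ^ p)
      = (((|h q.1 q.2|).toNNReal ^ p : ℝ≥0) : ℝ≥0∞) := fun q => e1 _ (abs_nonneg _)
  have hbd : ∃ H : ℝ, ∀ q : ℤ × (Fin d → ℤ), |h q.1 q.2| ≤ H := by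
    set T := (∑' q : ℤ × (Fin d → ℤ), ENNReal.ofReal (|h q.1 q.2| ^ p)).toReal with hT
    refine ⟨T ^ (1/p), fun q => ?_⟩
    have h1 : |h q.1 q.2| ^ p ≤ T := by
      have := ENNReal.toReal_mono hh (ENNReal.le_tsum (f := fun q : ℤ × (Fin d → ℤ) =>
        ENNReal.ofReal (|h q.1 q.2| ^ p)) q)
      rwa [ENNReal.toReal_ofReal (by positivity)] at this
    calc |h q.1 q.2| = (|h q.1 q.2| ^ p) ^ (1/p) := by
          rw [← Real.rpow_mul (abs_nonneg _), mul_one_div_cancel (by linarith), Real.rpow_one]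
      _ ≤ _ := Real.rpow_le_rpow (by positivity) h1 (by positivity)
  obtain ⟨H, hH⟩ := hbd
  simp_rw [e2] at hh ⊢
  refine (hmain (fun q => (|h q.1 q.2|).toNNReal) (fun q => (2 ^ (d+2) * sharp h q).toNNReal)
    (osc_le h H hH) hh).trans (le_of_eq ?_)
  have e3 : ∀ q, (((2 ^ (d+2) * sharp h q).toNNReal ^ p : ℝ≥0) : ℝ≥0∞)
      = ENNReal.ofReal ((2 ^ (d+2)) ^ p) * ENNReal.ofReal (sharp h q ^ p) := by
    intro q
    have := sharp_nonneg h q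
    rw [← e1 _ (by positivity), Real.mul_rpow (by positivity) this,
      ENNReal.ofReal_mul (by positivity)]
  simp_rw [e3]
  rw [ENNReal.tsum_mul_left, ENNReal.ofReal_mul (by positivity), ENNReal.ofReal_coe_nnreal, mul_assoc]
end
end
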